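/- Let R and M be as follows: R a commutative Noetherian ring with dualizing complex and M a G–Gorenstein R-module. If x = (x₁,…,xₙ) is maximal with respect to being simultaneously an M-regular sequence and an R-regular sequence, then M/xM is a Gorenstein injective R/xR-module. -/

import Mathlib

universe u

namespace GG

open RingTheory.Sequence

variable (R : Type u) [CommRing R]

/-- A module `N` is Gorenstein injective if it is a kernel in a `Hom(Inj,−)`-exact exact
doubly infinite complex of injective modules. -/
def IsGorensteinInjective (N : Type u) [AddCommGroup N] [Module R N] : Prop :=
  ∃ (X : ℤ → ModuleCat.{u} R) (d : ∀ n : ℤ, X n →ₗ[R] X (n + 1)),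
    (∀ n, Module.Injective R (X n)) ∧
    (∀ n, LinearMap.range (d n) = LinearMap.ker (d (n + 1))) ∧
    (∀ (I : ModuleCat.{u} R), Module.Injective R I →
      ∀ (n : ℤ) (φ : I →ₗ[R] X (n + 1)), (d (n + 1)).comp φ = 0 →
        ∃ ψ : I →ₗ[R] X n, (d n).comp ψ = φ) ∧
    Nonempty (N ≃ₗ[R] LinearMap.ker (d 0))

/-- A module `N` is Gorenstein projective if it is a kernel in a `Hom(−,Proj)`-exact exact
doubly infinite complex of projective modules. -/
def IsGorensteinProjective (N : Type u) [AddCommGroup N] [Module R N] : Prop :=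
  ∃ (X : ℤ → ModuleCat.{u} R) (d : ∀ n : ℤ, X n →ₗ[R] X (n + 1)),
    (∀ n, Module.Projective R (X n)) ∧
    (∀ n, LinearMap.range (d n) = LinearMap.ker (d (n + 1))) ∧
    (∀ (P : ModuleCat.{u} R), Module.Projective R P →
      ∀ (n : ℤ) (φ : X (n + 1) →ₗ[R] P), φ.comp (d n) = 0 →
        ∃ ψ : X (n + 1 + 1) →ₗ[R] P, ψ.comp (d (n + 1)) = φ) ∧
    Nonempty (N ≃ₗ[R] LinearMap.ker (d 0))

/-- A module `N` is Gorenstein flat if it is a kernel in an `(Inj ⊗ −)`-exact exact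
doubly infinite complex of flat modules. -/
def IsGorensteinFlat (N : Type u) [AddCommGroup N] [Module R N] : Prop :=
  ∃ (X : ℤ → ModuleCat.{u} R) (d : ∀ n : ℤ, X n →ₗ[R] X (n + 1)),
    (∀ n, Module.Flat R (X n)) ∧
    (∀ n, LinearMap.range (d n) = LinearMap.ker (d (n + 1))) ∧
    (∀ (I : ModuleCat.{u} R), Module.Injective R I →
      ∀ n : ℤ, LinearMap.range (LinearMap.lTensor (R := R) I (d n)) =
        LinearMap.ker (LinearMap.lTensor (R := R) I (d (n + 1)))) ∧
    Nonempty (N ≃ₗ[R] LinearMap.ker (d 0))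

/-- Existence of a right resolution of length `≤ n` by modules satisfying `P`. -/
def CoresolutionLE (P : ModuleCat.{u} R → Prop) (M : Type u) [AddCommGroup M] [Module R M]
    (n : ℕ) : Prop :=
  ∃ (G : ℕ → ModuleCat.{u} R) (d : ∀ i : ℕ, G i →ₗ[R] G (i + 1)) (ε : M →ₗ[R] G 0),
    (∀ i, P (G i)) ∧ Function.Injective ε ∧
    LinearMap.range ε = LinearMap.ker (d 0) ∧
    (∀ i, LinearMap.range (d i) = LinearMap.ker (d (i + 1))) ∧
    (∀ i, n < i → ∀ x : G i, x = 0)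

/-- Existence of a left resolution of length `≤ n` by modules satisfying `P`. -/
def ResolutionLE (P : ModuleCat.{u} R → Prop) (M : Type u) [AddCommGroup M] [Module R M]
    (n : ℕ) : Prop :=
  ∃ (G : ℕ → ModuleCat.{u} R) (d : ∀ i : ℕ, G (i + 1) →ₗ[R] G i) (ε : G 0 →ₗ[R] M),
    (∀ i, P (G i)) ∧ Function.Surjective ε ∧
    LinearMap.ker ε = LinearMap.range (d 0) ∧
    (∀ i, LinearMap.ker (d i) = LinearMap.range (d (i + 1))) ∧
    (∀ i, n < i → ∀ x : G i, x = 0)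

/-- `Gid_R M ≤ n`. -/
def gidLE (M : Type u) [AddCommGroup M] [Module R M] (n : ℕ) : Prop :=
  CoresolutionLE R (fun N => IsGorensteinInjective R N) M n

/-- `id_R M ≤ n`. -/
def idLE (M : Type u) [AddCommGroup M] [Module R M] (n : ℕ) : Prop :=
  CoresolutionLE R (fun N => Module.Injective R N) M n

/-- `pd_R M ≤ n`. -/
def pdLE (M : Type u) [AddCommGroup M] [Module R M] (n : ℕ) : Prop :=
  ResolutionLE R (fun N => Module.Projective R N) M n

/-- `fd_R M ≤ n`. -/
def fdLE (M : Type u) [AddCommGroup M] [Module R M] (n : ℕ) : Prop :=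
  ResolutionLE R (fun N => Module.Flat R N) M n

/-- `Gfd_R M ≤ n`. -/
def gfdLE (M : Type u) [AddCommGroup M] [Module R M] (n : ℕ) : Prop :=
  ResolutionLE R (fun N => IsGorensteinFlat R N) M n

/-- Gorenstein injective dimension, as an extended natural number. -/
noncomputable def gid (M : Type u) [AddCommGroup M] [Module R M] : ℕ∞ :=
  sInf {c : ℕ∞ | ∃ n : ℕ, c = n ∧ gidLE R M n}

/-- The depth of a module over a local ring: the supremum of the lengths of regular
sequences contained in the maximal ideal. -/
noncomputable def mdepth [IsLocalRing R] (M : Type u) [AddCommGroup M] [Module R M] : ℕ∞ :=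
  sSup {c : ℕ∞ | ∃ rs : List R, c = rs.length ∧
    (∀ r ∈ rs, r ∈ IsLocalRing.maximalIdeal R) ∧ RingTheory.Sequence.IsRegular M rs}

/-- The Krull dimension of a module: the Krull dimension of its support. -/
noncomputable def mdim (M : Type u) [AddCommGroup M] [Module R M] : WithBot ℕ∞ :=
  Order.krullDim ↥(Module.support R M)

/-- The height of a prime in the support of `M`. -/
noncomputable def htM (M : Type u) [AddCommGroup M] [Module R M] (p : PrimeSpectrum R) : ℕ∞ :=
  ⨆ h : p ∈ Module.support R M, Order.height (⟨p, h⟩ : ↥(Module.support R M))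

/-- A Cohen–Macaulay module over a local ring: depth equals Krull dimension. -/
def IsCMModule [IsLocalRing R] (M : Type u) [AddCommGroup M] [Module R M] : Prop :=
  (mdepth R M : WithBot ℕ∞) = mdim R M

/-- A maximal Cohen–Macaulay module over a local ring. -/
def IsMaximalCM [IsLocalRing R] (M : Type u) [AddCommGroup M] [Module R M] : Prop :=
  IsCMModule R M ∧ mdim R M = ringKrullDim R

/-- A Cohen–Macaulay local ring. -/
def IsCMLocalRing [IsLocalRing R] : Prop :=
  (mdepth R R : WithBot ℕ∞) = ringKrullDim R

/-- A Gorenstein local ring: a Noetherian local ring of finite self-injective dimension. -/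
def IsGorensteinLocalRing [IsLocalRing R] : Prop :=
  IsNoetherianRing R ∧ ∃ n : ℕ, idLE R R n

/-- A regular local ring: Noetherian, and the maximal ideal is generated by `dim R` elements. -/
def IsRegularLocal [IsLocalRing R] : Prop :=
  IsNoetherianRing R ∧ ∃ s : Finset R, Ideal.span (s : Set R) = IsLocalRing.maximalIdeal R ∧
    (s.card : WithBot ℕ∞) = ringKrullDim R

/-- A (not necessarily local) Gorenstein ring: all localizations at primes are Gorenstein. -/
def IsGorensteinRing : Prop :=
  ∀ p : PrimeSpectrum R, ∃ n : ℕ,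
    idLE (Localization.AtPrime p.asIdeal) (Localization.AtPrime p.asIdeal) n

/-- `R` admits a dualizing complex; by Kawasaki's theorem this is equivalent to being a
homomorphic image of a finite-dimensional Gorenstein ring. -/
def HasDualizingComplex : Prop :=
  ∃ Q : CommRingCat.{u}, IsNoetherianRing Q ∧ ringKrullDim Q < ⊤ ∧ IsGorensteinRing Q ∧
    ∃ f : Q →+* R, Function.Surjective f

section Cousin

/-- The product of the localizations of `N` at the primes in `S`. -/
noncomputable abbrev locProd (S : Set (PrimeSpectrum R)) (N : Type u) [AddCommGroup N]
    [Module R N] : Type u :=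
  Π p : S, LocalizedModule p.1.asIdeal.primeCompl N

/-- The submodule of the product of localizations consisting of finitely supported families;
this is the direct sum `⊕_{p ∈ S} N_p`. -/
noncomputable def finSupp (S : Set (PrimeSpectrum R)) (N : Type u) [AddCommGroup N]
    [Module R N] : Submodule R (locProd R S N) where
  carrier := {f | {p : S | f p ≠ 0}.Finite}
  add_mem' := by
    intro f g hf hg
    refine (hf.union hg).subset ?_
    intro p hp
    by_contra h
    simp only [Set.mem_union, Set.mem_setOf_eq, not_or, not_not] at h
    exact hp (by simp [Pi.add_apply, h.1, h.2])
  zero_mem' := by simp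
  smul_mem' := by
    intro c f hf
    refine hf.subset ?_
    intro p hp
    by_contra h
    simp only [Set.mem_setOf_eq, not_not] at h
    exact hp (by simp [Pi.smul_apply, h])

/-- The canonical map `N → ∏_{p ∈ S} N_p`. -/
noncomputable def thetaFull (S : Set (PrimeSpectrum R)) (N : Type u) [AddCommGroup N]
    [Module R N] : N →ₗ[R] locProd R S N :=
  LinearMap.pi fun p => LocalizedModule.mkLinearMap p.1.asIdeal.primeCompl N

/-- The cokernel of `N → ⊕_{p ∈ S} N_p` (computed inside the direct sum). -/
noncomputable abbrev nextKType (S : Set (PrimeSpectrum R)) (N : Type u) [AddCommGroup N]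
    [Module R N] : Type u :=
  ↥(finSupp R S N) ⧸
    (Submodule.comap (finSupp R S N).subtype (LinearMap.range (thetaFull R S N)))

/-- The sequence of "kernel/cokernel" modules in the inductive construction
of the Cousin complex of `M` with respect to the filtration `F`. -/
noncomputable def cousinK (F : ℕ → Set (PrimeSpectrum R)) (M : ModuleCat.{u} R) :
    ℕ → ModuleCat.{u} R
  | 0 => M
  | n + 1 => ModuleCat.of R (nextKType R (F n \ F (n + 1)) (cousinK F M n))

/-- The `n`-th term `M^n = ⊕_{p ∈ ∂F_n} (coker d^{n-2})_p` of the Cousin complex. -/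
noncomputable abbrev cousinC (F : ℕ → Set (PrimeSpectrum R)) (M : ModuleCat.{u} R) (n : ℕ) :
    Type u :=
  ↥(finSupp R (F n \ F (n + 1)) (cousinK R F M n))

/-- The canonical map from the `n`-th cokernel into the product of its localizations. -/
noncomputable def cousinTheta (F : ℕ → Set (PrimeSpectrum R)) (M : ModuleCat.{u} R) (n : ℕ) :
    (cousinK R F M n) →ₗ[R] locProd R (F n \ F (n + 1)) (cousinK R F M n) :=
  thetaFull R _ _

/-- The (full) `n`-th differential of the Cousin complex, from `M^n` to the product at
level `n+1` (it lands inside the direct sum `M^{n+1}`). -/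
noncomputable def cousinD (F : ℕ → Set (PrimeSpectrum R)) (M : ModuleCat.{u} R) (n : ℕ) :
    (cousinC R F M n) →ₗ[R] locProd R (F (n + 1) \ F (n + 2)) (cousinK R F M (n + 1)) :=
  (cousinTheta R F M (n + 1)).comp
    (Submodule.mkQ (Submodule.comap (finSupp R (F n \ F (n + 1)) (cousinK R F M n)).subtype
      (LinearMap.range (thetaFull R (F n \ F (n + 1)) (cousinK R F M n)))))

/-- `F` is a filtration of `Spec R`: descending, and every element of `∂F_n = F_n \ F_{n+1}`
is a minimal member of `F_n`. -/
def IsFiltration (F : ℕ → Set (PrimeSpectrum R)) : Prop :=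
  (∀ n, F (n + 1) ⊆ F n) ∧
    ∀ n, ∀ p ∈ F n \ F (n + 1), ∀ q ∈ F n, q ≤ p → q = p

/-- The filtration `F` admits `M`. -/
def Admits (F : ℕ → Set (PrimeSpectrum R)) (M : Type u) [AddCommGroup M] [Module R M] : Prop :=
  Module.support R M ⊆ F 0

/-- The `M`-height filtration `K_i = {p ∈ Supp M | ht_M p ≥ i}`. -/
noncomputable def heightFiltration (M : Type u) [AddCommGroup M] [Module R M] :
    ℕ → Set (PrimeSpectrum R) :=
  fun i => {p | p ∈ Module.support R M ∧ (i : ℕ∞) ≤ htM R M p}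

/-- The Cousin complex `C(F, M)` is exact at `M, M⁰, …, M^t`
(together with the well-definedness of the differentials into the direct sums). -/
def CousinPartiallyExact (F : ℕ → Set (PrimeSpectrum R)) (M : ModuleCat.{u} R) (t : ℕ) : Prop :=
  (∀ n, LinearMap.range (cousinTheta R F M n) ≤ finSupp R (F n \ F (n + 1)) (cousinK R F M n)) ∧
  Function.Injective (cousinTheta R F M 0) ∧
  (∀ n ≤ t, LinearMap.ker (cousinD R F M n) =
    Submodule.comap (finSupp R (F n \ F (n + 1)) (cousinK R F M n)).subtype
      (LinearMap.range (cousinTheta R F M n)))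

/-- The Cousin complex `C(F, M)` is exact and all of its terms satisfy `P`, i.e. it provides
a `P`-resolution of `M`. -/
def CousinResolves (F : ℕ → Set (PrimeSpectrum R)) (M : ModuleCat.{u} R)
    (P : ModuleCat.{u} R → Prop) : Prop :=
  (∀ n, LinearMap.range (cousinTheta R F M n) ≤ finSupp R (F n \ F (n + 1)) (cousinK R F M n)) ∧
  Function.Injective (cousinTheta R F M 0) ∧
  (∀ n, LinearMap.ker (cousinD R F M n) =
    Submodule.comap (finSupp R (F n \ F (n + 1)) (cousinK R F M n)).subtype
      (LinearMap.range (cousinTheta R F M n))) ∧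
  (∀ n, P (ModuleCat.of R (cousinC R F M n)))

/-- A G–Gorenstein module: a nonzero finitely generated module whose Cousin complex with
respect to the `M`-height filtration is a Gorenstein injective resolution. -/
def IsGGorenstein (M : ModuleCat.{u} R) : Prop :=
  (∃ x : M, x ≠ 0) ∧ Module.Finite R M ∧
    CousinResolves R (heightFiltration R M) M (fun N => IsGorensteinInjective R N)

/-- A Gorenstein module: a nonzero finitely generated module whose Cousin complex with
respect to the `M`-height filtration is an injective resolution. -/
def IsGorensteinModule (M : ModuleCat.{u} R) : Prop :=
  (∃ x : M, x ≠ 0) ∧ Module.Finite R M ∧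
    CousinResolves R (heightFiltration R M) M (fun N => Module.Injective R N)

end Cousin

/-- A system of parameters of a local ring. -/
def IsSOP [IsLocalRing R] (rs : List R) : Prop :=
  (rs.length : WithBot ℕ∞) = ringKrullDim R ∧
    (∀ r ∈ rs, r ∈ IsLocalRing.maximalIdeal R) ∧
    IsLocalRing.maximalIdeal R ≤ (Ideal.span {r | r ∈ rs}).radical

/-- A balanced big Cohen–Macaulay module: every system of parameters of `R` is a regular
sequence on `M`. -/
def IsBalancedBigCM [IsLocalRing R] (M : Type u) [AddCommGroup M] [Module R M] : Prop :=
  ∀ rs : List R, IsSOP R rs → RingTheory.Sequence.IsRegular M rs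

end GG

namespace GG

section Loc
variable {R : Type u} [CommRing R] {N : Type u} [AddCommGroup N] [Module R N]

lemma loc_surj (p : Ideal R) [p.IsPrime] (v : LocalizedModule p.primeCompl N) :
    ∃ s, s ∉ p ∧ ∃ k, s • v = LocalizedModule.mkLinearMap p.primeCompl N k := by
  obtain ⟨⟨k, s⟩, h⟩ := IsLocalizedModule.surj p.primeCompl
    (LocalizedModule.mkLinearMap p.primeCompl N) v
  exact ⟨s.1, s.2, k, h⟩

lemma loc_zero (p : Ideal R) [p.IsPrime] (k : N) :
    LocalizedModule.mkLinearMap p.primeCompl N k = 0 ↔ ∃ s, s ∉ p ∧ s • k = 0 := by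
  rw [IsLocalizedModule.eq_zero_iff p.primeCompl]
  exact ⟨fun ⟨s, h⟩ => ⟨s.1, s.2, h⟩, fun ⟨s, h, h'⟩ => ⟨⟨s, h⟩, h'⟩⟩

lemma loc_inj (p : Ideal R) [p.IsPrime] {s : R} (hs : s ∉ p)
    {v : LocalizedModule p.primeCompl N} (h : s • v = 0) : v = 0 := by
  apply IsLocalizedModule.smul_injective (S := p.primeCompl)
    (LocalizedModule.mkLinearMap p.primeCompl N) ⟨s, hs⟩
  show s • v = s • 0
  rw [h, smul_zero]

lemma loc_div (p : Ideal R) [p.IsPrime] {s : R} (hs : s ∉ p)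
    (v : LocalizedModule p.primeCompl N) : ∃ w, s • w = v := by
  have := IsLocalizedModule.map_units (S := p.primeCompl)
    (LocalizedModule.mkLinearMap p.primeCompl N) ⟨s, hs⟩
  rw [Module.End.isUnit_iff] at this
  exact this.2 v

end Loc

/-- abstract Cousin data -/
structure Cous (R : Type u) [CommRing R] (F : ℕ → Set (PrimeSpectrum R)) (K : ℕ → ModuleCat.{u} R)
    (π : ∀ j, finSupp R (F j \ F (j + 1)) (K j) →ₗ[R] K (j + 1)) : Prop where
  rng : ∀ j, LinearMap.range (thetaFull R (F j \ F (j + 1)) (K j)) ≤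
    finSupp R (F j \ F (j + 1)) (K j)
  inj : ∀ j, Function.Injective (thetaFull R (F j \ F (j + 1)) (K j))
  surj : ∀ j, Function.Surjective (π j)
  ker : ∀ j c, π j c = 0 ↔ ∃ k, thetaFull R (F j \ F (j + 1)) (K j) k = c.1
  min : ∀ j, ∀ p ∈ F j \ F (j + 1), ∀ q ∈ F j, q ≤ p → q = p
  supp0 : Module.support R (K 0) ⊆ F 0

lemma htM_of_mem {R : Type u} [CommRing R] {M : Type u} [AddCommGroup M] [Module R M]
    {p : PrimeSpectrum R} (h : p ∈ Module.support R M) :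
    htM R M p = Order.height (⟨p, h⟩ : ↥(Module.support R M)) := by
  simp [htM, h]

lemma cous_of (R : Type u) [CommRing R] (M : ModuleCat.{u} R) (P)
    (h : CousinResolves R (heightFiltration R M) M P) :
    ∃ π, Cous R (heightFiltration R M) (cousinK R (heightFiltration R M) M) π := by
  obtain ⟨h1, h2, h3, -⟩ := h
  refine ⟨fun j => Submodule.mkQ (Submodule.comap (finSupp R _ _).subtype
      (LinearMap.range (thetaFull R _ _))), h1, ?_, ?_, ?_, ?_, ?_⟩
  · intro j
    cases j with
    | zero => exact h2
    | succ j =>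
      rw [← LinearMap.ker_eq_bot, eq_bot_iff]
      intro x hx
      obtain ⟨c, rfl⟩ := Submodule.mkQ_surjective _ x
      have : c ∈ LinearMap.ker (cousinD R (heightFiltration R M) M j) := hx
      rw [h3] at this
      exact (Submodule.Quotient.mk_eq_zero _).2 this
  · intro j
    exact Submodule.mkQ_surjective _
  · intro j c
    exact (Submodule.Quotient.mk_eq_zero _)
  · rintro j p ⟨⟨hp, hj⟩, hp2⟩ q ⟨hq, hqj⟩ hqp
    by_contra hne
    have hlt : q < p := lt_of_le_of_ne hqp hne
    apply hp2
    refine ⟨hp, ?_⟩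
    rw [htM_of_mem hp]
    rw [htM_of_mem hq] at hqj
    have : (⟨q, hq⟩ : ↥(Module.support R M)) < ⟨p, hp⟩ := hlt
    have h4 := Order.height_add_one_le this
    push_cast
    exact le_trans (by gcongr) h4
  · intro p hp
    exact ⟨hp, by simp⟩

namespace Cous
variable {R : Type u} [CommRing R] {F : ℕ → Set (PrimeSpectrum R)} {K : ℕ → ModuleCat.{u} R}
    {π : ∀ j, finSupp R (F j \ F (j + 1)) (K j) →ₗ[R] K (j + 1)}

lemma pow_aux (D : Cous R F K π) (i : ℕ)
    (H : ∀ q, q ∉ F i → ∀ k : K i, ∃ r, r ∉ q.asIdeal ∧ r • k = 0)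
    {p : PrimeSpectrum R} (hp : p ∈ F i \ F (i + 1)) {a : R} (ha : a ∈ p.asIdeal) (k : K i) :
    ∃ n : ℕ, ∃ u, u ∉ p.asIdeal ∧ (u * a ^ n) • k = 0 := by
  by_contra hcon
  push Not at hcon
  let J : Ideal R := LinearMap.ker (LinearMap.toSpanSingleton R (K i) k)
  have hJ : ∀ r, r ∈ J ↔ r • k = 0 := fun r => Iff.rfl
  have hd : Disjoint (J : Set R) ((p.asIdeal.primeCompl ⊔ Submonoid.powers a : Submonoid R) : Set R) := by
    rw [Set.disjoint_left]
    intro r hr hr2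
    rw [SetLike.mem_coe, Submonoid.mem_sup] at hr2
    obtain ⟨u, hu, _, ⟨n, rfl⟩, rfl⟩ := hr2
    exact hcon n u hu ((hJ _).1 hr)
  obtain ⟨q, hq, hJq, hdq⟩ := Ideal.exists_le_prime_disjoint J _ hd
  rw [Set.disjoint_left] at hdq
  have hqF : (⟨q, hq⟩ : PrimeSpectrum R) ∈ F i := by
    by_contra hn
    obtain ⟨r, hr, hr2⟩ := H _ hn k
    exact hr (hJq ((hJ r).2 hr2))
  have hle : (⟨q, hq⟩ : PrimeSpectrum R) ≤ p := by
    intro x hx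
    by_contra hxp
    exact hdq hx (Submonoid.mem_sup_left hxp)
  have := D.min i p hp _ hqF hle
  have haq : a ∈ q := by
    have : q = p.asIdeal := congrArg PrimeSpectrum.asIdeal this
    rw [this]; exact ha
  exact hdq haq (Submonoid.mem_sup_right (Submonoid.mem_powers a))

lemma pow_aux' (D : Cous R F K π) (i : ℕ)
    (H : ∀ q, q ∉ F i → ∀ k : K i, ∃ r, r ∉ q.asIdeal ∧ r • k = 0)
    {p : PrimeSpectrum R} (hp : p ∈ F i \ F (i + 1)) {a : R} (ha : a ∈ p.asIdeal)
    (v : LocalizedModule p.asIdeal.primeCompl (K i)) :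
    ∃ n : ℕ, a ^ n • v = 0 := by
  obtain ⟨s, hs, k, hk⟩ := loc_surj p.asIdeal v
  obtain ⟨n, u, hu, h⟩ := pow_aux D i H hp ha k
  refine ⟨n, ?_⟩
  apply loc_inj p.asIdeal (s := u * s) (fun h => (p.2.mem_or_mem h).elim hu hs)
  rw [show (u * s) • a ^ n • v = (u * a ^ n) • s • v by simp only [smul_smul]; congr 1; ring, hk,
    ← map_smul, h, map_zero]

/-- common annihilator for finitely supported families -/
lemma finSupp_ann {S : Set (PrimeSpectrum R)} {N : Type u} [AddCommGroup N] [Module R N]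
    (c : locProd R S N) (hc : c ∈ finSupp R S N) (q : PrimeSpectrum R)
    (h : ∀ p, ∃ r, r ∉ q.asIdeal ∧ r • c p = 0) : ∃ r, r ∉ q.asIdeal ∧ r • c = 0 := by
  classical
  choose r hr hrc using h
  have hf : {p : S | c p ≠ 0}.Finite := hc
  refine ⟨∏ p ∈ hf.toFinset, r p, ?_, ?_⟩
  · rw [q.2.prod_mem_iff]
    push Not
    exact fun p _ => hr p
  · ext p
    by_cases hp : c p = 0
    · simp [hp]
    · have : p ∈ hf.toFinset := by simpa using hp
      rw [← Finset.prod_erase_mul _ _ this, mul_smul]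
      simp [hrc]

lemma supp (D : Cous R F K π) (i : ℕ) :
    ∀ q, q ∉ F i → ∀ k : K i, ∃ r, r ∉ q.asIdeal ∧ r • k = 0 := by
  induction i with
  | zero =>
    intro q hq k
    have : q ∉ Module.support R (K 0) := fun h => hq (D.supp0 h)
    rw [Module.notMem_support_iff'] at this
    exact this k
  | succ i ih =>
    intro q hq k
    obtain ⟨c, rfl⟩ := D.surj i k
    suffices ∃ r, r ∉ q.asIdeal ∧ ∃ k, thetaFull R (F i \ F (i + 1)) (K i) k = r • c.1 by
      obtain ⟨r, hr, k, hk⟩ := this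
      exact ⟨r, hr, by rw [← map_smul]; exact (D.ker i _).2 ⟨k, hk⟩⟩
    by_cases hqi : q ∈ F i
    · have hqS : q ∈ F i \ F (i + 1) := ⟨hqi, hq⟩
      obtain ⟨s, hs, k, hk⟩ := loc_surj q.asIdeal (c.1 ⟨q, hqS⟩)
      obtain ⟨r, hr, h⟩ := finSupp_ann (s • c.1 - thetaFull R _ _ k)
        (Submodule.sub_mem _ (Submodule.smul_mem _ _ c.2) (D.rng i ⟨k, rfl⟩)) q (by
          intro p
          by_cases hpq : p.1 = q
          · obtain ⟨p, hp⟩ := p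
            subst hpq
            refine ⟨1, p.asIdeal.primeCompl.one_mem, ?_⟩
            rw [Pi.sub_apply, Pi.smul_apply, hk]
            simp [thetaFull]
          · have : ¬ p.1.asIdeal ≤ q.asIdeal := fun h => hpq (D.min i q hqS p.1 p.2.1 h)
            obtain ⟨a, ha, haq⟩ := SetLike.not_le_iff_exists.1 this
            obtain ⟨n, hn⟩ := pow_aux' D i ih p.2 ha ((s • c.1 - thetaFull R (F i \ F (i + 1)) (K i) k : locProd R (F i \ F (i + 1)) (K i)) p)
            exact ⟨a ^ n, fun h => haq (q.2.mem_of_pow_mem _ h), hn⟩)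
      refine ⟨r * s, fun h => (q.2.mem_or_mem h).elim hr hs, r • k, ?_⟩
      rw [map_smul, mul_smul]
      rw [smul_sub, sub_eq_zero] at h
      exact h.symm
    · obtain ⟨r, hr, h⟩ := finSupp_ann c.1 c.2 q (by
        intro p
        obtain ⟨s, hs, k, hk⟩ := loc_surj p.1.asIdeal (c.1 p)
        obtain ⟨r, hr, h⟩ := ih q hqi k
        refine ⟨r, hr, loc_inj p.1.asIdeal hs ?_⟩
        rw [smul_comm, hk, ← map_smul, h, map_zero])
      exact ⟨r, hr, 0, by rw [h, map_zero]⟩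

lemma tors (D : Cous R F K π) (i : ℕ) {p : PrimeSpectrum R} (hp : p ∈ F i \ F (i + 1))
    {a : R} (ha : a ∈ p.asIdeal) (v : LocalizedModule p.asIdeal.primeCompl (K i)) :
    ∃ n : ℕ, a ^ n • v = 0 := pow_aux' D i (D.supp i) hp ha v

end Cous
end GG

namespace GG

/-- the submodule of elements killed by `J` -/
def tor {R : Type u} [CommRing R] (J : Ideal R) (N : Type u) [AddCommGroup N] [Module R N] :
    Submodule R N where
  carrier := {x | ∀ a ∈ J, a • x = 0}
  add_mem' := fun {x y} hx hy a ha => by rw [smul_add, hx a ha, hy a ha, add_zero]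
  zero_mem' := fun a _ => smul_zero a
  smul_mem' := fun c x hx a ha => by rw [smul_comm, hx a ha, smul_zero]

lemma mem_tor {R : Type u} [CommRing R] {J : Ideal R} {N : Type u} [AddCommGroup N] [Module R N]
    {x : N} : x ∈ tor J N ↔ ∀ a ∈ J, a • x = 0 := Iff.rfl

lemma mem_tor_sup {R : Type u} [CommRing R] {J : Ideal R} {N : Type u} [AddCommGroup N]
    [Module R N] {x : N} {y : R} :
    x ∈ tor (J ⊔ Ideal.span {y}) N ↔ x ∈ tor J N ∧ y • x = 0 := by
  constructor
  · intro h
    exact ⟨fun a ha => h a (Ideal.mem_sup_left ha),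
      h y (Ideal.mem_sup_right (Ideal.mem_span_singleton_self y))⟩
  · rintro ⟨h1, h2⟩ a ha
    obtain ⟨b, hb, c, hc, rfl⟩ := Submodule.mem_sup.1 ha
    obtain ⟨r, rfl⟩ := Ideal.mem_span_singleton'.1 hc
    rw [add_smul, h1 b hb, mul_smul, h2, smul_zero, zero_add]

lemma tor_lift {R : Type u} [CommRing R] [IsNoetherianRing R] {J : Ideal R}
    {N : Type u} [AddCommGroup N] [Module R N] (p : Ideal R) [p.IsPrime]
    (v : LocalizedModule p.primeCompl N) (hv : v ∈ tor J (LocalizedModule p.primeCompl N)) :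
    ∃ s, s ∉ p ∧ ∃ k ∈ tor J N, s • v = LocalizedModule.mkLinearMap p.primeCompl N k := by
  classical
  obtain ⟨s, hs, k, hk⟩ := loc_surj p v
  have h1 : ∀ a : J, ∃ u, u ∉ p ∧ u • a.1 • k = 0 := by
    intro a
    rw [← loc_zero, map_smul, ← hk, smul_comm, hv a.1 a.2, smul_zero]
  choose u hu hu2 using h1
  obtain ⟨t, ht⟩ := (isNoetherianRing_iff_ideal_fg R).1 inferInstance J
  have htJ : ∀ a ∈ t, a ∈ J := fun a ha => ht ▸ Ideal.subset_span ha
  let U : R := ∏ a ∈ t.attach, u ⟨a.1, htJ a.1 a.2⟩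
  have hU : U ∉ p := by
    rw [(inferInstance : p.IsPrime).prod_mem_iff]
    push Not
    exact fun a _ => hu _
  refine ⟨U * s, fun h => (Ideal.IsPrime.mem_or_mem inferInstance h).elim hU hs, U • k, ?_, ?_⟩
  · intro a ha
    have : J ≤ LinearMap.ker (LinearMap.toSpanSingleton R N (U • k)) := by
      rw [← ht, Ideal.span_le]
      intro a ha
      show a • U • k = 0
      have h3 : (⟨a, ha⟩ : {x // x ∈ t}) ∈ t.attach := Finset.mem_attach _ _
      show a • (∏ a ∈ t.attach, u ⟨a.1, htJ a.1 a.2⟩) • k = 0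
      rw [← Finset.prod_erase_mul _ _ h3, mul_smul, smul_comm, smul_comm a (u _) k, hu2, smul_zero]
    exact this ha
  · rw [map_smul, mul_smul, hk]

/-- componentwise division in the direct sum -/
lemma finSupp_div {R : Type u} [CommRing R] {S : Set (PrimeSpectrum R)} {J : Ideal R}
    {N : Type u} [AddCommGroup N] [Module R N] (y : R) (c : finSupp R S N)
    (h : ∀ p : S, ∃ w ∈ tor J (LocalizedModule p.1.asIdeal.primeCompl N), y • w = c.1 p) :
    ∃ c1 ∈ tor J (finSupp R S N), y • c1 = c := by
  classical
  choose w hw hyw using h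
  refine ⟨⟨fun p => if c.1 p = 0 then 0 else w p, ?_⟩, ?_, ?_⟩
  · refine Set.Finite.subset c.2 ?_
    intro p hp h0
    exact hp (if_pos h0)
  · intro a ha
    apply Subtype.ext
    funext p
    show a • (if c.1 p = 0 then 0 else w p) = 0
    split_ifs
    · exact smul_zero a
    · exact hw p a ha
  · apply Subtype.ext
    funext p
    show y • (if c.1 p = 0 then 0 else w p) = c.1 p
    split_ifs with h0
    · rw [smul_zero, h0]
    · exact hyw p

lemma tor_comp {R : Type u} [CommRing R] {S : Set (PrimeSpectrum R)} {J : Ideal R}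
    {N : Type u} [AddCommGroup N] [Module R N] {c : finSupp R S N} (hc : c ∈ tor J (finSupp R S N))
    (p : S) : c.1 p ∈ tor J (LocalizedModule p.1.asIdeal.primeCompl N) := by
  intro a ha
  have := hc a ha
  exact congrFun (congrArg Subtype.val this) p

namespace Cous
variable {R : Type u} [CommRing R] {F : ℕ → Set (PrimeSpectrum R)} {K : ℕ → ModuleCat.{u} R}
    {π : ∀ j, finSupp R (F j \ F (j + 1)) (K j) →ₗ[R] K (j + 1)}

/-- the inclusion of `K_j` in `C_j` -/
noncomputable def io (D : Cous R F K π) (j : ℕ) : K j →ₗ[R] finSupp R (F j \ F (j + 1)) (K j) :=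
  LinearMap.codRestrict _ (thetaFull R (F j \ F (j + 1)) (K j)) fun k => D.rng j ⟨k, rfl⟩

lemma io_inj (D : Cous R F K π) (j : ℕ) : Function.Injective (D.io j) := fun _ _ h =>
  D.inj j (congrArg Subtype.val h)

lemma io_ker (D : Cous R F K π) (j : ℕ) (c) : π j c = 0 ↔ ∃ k, D.io j k = c := by
  rw [D.ker]
  exact ⟨fun ⟨k, h⟩ => ⟨k, Subtype.ext h⟩, fun ⟨k, h⟩ => ⟨k, congrArg Subtype.val h⟩⟩

lemma io_tor (D : Cous R F K π) (j : ℕ) {J : Ideal R} {k : K j}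
    (h : D.io j k ∈ tor J (finSupp R (F j \ F (j + 1)) (K j))) : k ∈ tor J (K j) := by
  intro a ha
  apply D.io_inj j
  rw [map_smul, h a ha, map_zero]

lemma map_tor {N N' : Type u} [AddCommGroup N] [Module R N] [AddCommGroup N'] [Module R N']
    {J : Ideal R} (f : N →ₗ[R] N') {x : N} (h : x ∈ tor J N) : f x ∈ tor J N' := by
  intro a ha
  rw [← map_smul, h a ha, map_zero]

lemma C_div [IsNoetherianRing R] (j : ℕ) {J : Ideal R} {y : R}
    (h : ∀ k ∈ tor J (K j), ∃ k1 ∈ tor J (K j), y • k1 = k) :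
    ∀ c ∈ tor J (finSupp R (F j \ F (j + 1)) (K j)),
      ∃ c1 ∈ tor J (finSupp R (F j \ F (j + 1)) (K j)), y • c1 = c := by
  intro c hc
  apply finSupp_div
  intro p
  obtain ⟨s, hs, k, hk, hsk⟩ := tor_lift p.1.asIdeal (c.1 p) (tor_comp hc p)
  obtain ⟨k1, hk1, rfl⟩ := h k hk
  obtain ⟨w, hw⟩ := loc_div p.1.asIdeal hs (LocalizedModule.mkLinearMap p.1.asIdeal.primeCompl _ k1)
  refine ⟨w, ?_, ?_⟩
  · intro a ha
    apply loc_inj p.1.asIdeal hs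
    rw [smul_comm, hw, ← map_smul, hk1 a ha, map_zero]
  · rw [← sub_eq_zero]
    apply loc_inj p.1.asIdeal hs
    rw [smul_sub, smul_comm, hw, hsk, map_smul, sub_self]

lemma loc_inj_of [IsNoetherianRing R] (j : ℕ) {J : Ideal R} {y : R}
    (h : ∀ k ∈ tor J (K j), y • k = 0 → k = 0) (p : PrimeSpectrum R)
    (v : LocalizedModule p.asIdeal.primeCompl (K j)) (hv : v ∈ tor J _) (hy : y • v = 0) :
    v = 0 := by
  obtain ⟨s, hs, k, hk, hsk⟩ := tor_lift p.asIdeal v hv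
  apply loc_inj p.asIdeal hs
  rw [hsk, loc_zero]
  have : LocalizedModule.mkLinearMap p.asIdeal.primeCompl (K j) (y • k) = 0 := by
    rw [map_smul, ← hsk, smul_comm, hy, smul_zero]
  rw [loc_zero] at this
  obtain ⟨u, hu, h2⟩ := this
  exact ⟨u, hu, h _ (Submodule.smul_mem _ u hk) (by rw [smul_comm]; exact h2)⟩

lemma C_bij [IsNoetherianRing R] (D : Cous R F K π) (j : ℕ) {J : Ideal R} {y : R}
    (h : ∀ k ∈ tor J (K j), y • k = 0 → k = 0) :
    (∀ c ∈ tor J (finSupp R (F j \ F (j + 1)) (K j)), y • c = 0 → c = 0) ∧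
    ∀ c ∈ tor J (finSupp R (F j \ F (j + 1)) (K j)),
      ∃ c1 ∈ tor J (finSupp R (F j \ F (j + 1)) (K j)), y • c1 = c := by
  constructor
  · intro c hc hy
    apply Subtype.ext
    funext p
    exact loc_inj_of j h p.1 _ (tor_comp hc p) (congrFun (congrArg Subtype.val hy) p)
  · intro c hc
    apply finSupp_div
    intro p
    by_cases hyp : y ∈ p.1.asIdeal
    · refine ⟨0, Submodule.zero_mem _, ?_⟩
      obtain ⟨n, hn⟩ := D.tors j p.2 hyp (c.1 p)
      rw [smul_zero]
      symm
      induction n with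
      | zero => simpa using hn
      | succ n ih =>
        apply ih
        apply loc_inj_of j h p.1 _ (Submodule.smul_mem _ _ (tor_comp hc p))
        rw [smul_smul, ← pow_succ']
        exact hn
    · obtain ⟨w, hw⟩ := loc_div p.1.asIdeal hyp (c.1 p)
      refine ⟨w, ?_, hw⟩
      intro a ha
      apply loc_inj p.1.asIdeal hyp
      rw [smul_comm, hw, tor_comp hc p a ha]

/-- The stage reached after dividing by a regular sequence generating `J`. -/
def Stage (K : ℕ → ModuleCat.{u} R)
    (π : ∀ j, finSupp R (F j \ F (j + 1)) (K j) →ₗ[R] K (j + 1)) (J : Ideal R) (i : ℕ) : Prop :=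
  (∃ f : K 0 →ₗ[R] K i, LinearMap.range f = tor J (K i) ∧
    LinearMap.ker f = J • (⊤ : Submodule R (K 0))) ∧
  ∀ j ≥ i, ∀ k ∈ tor J (K (j + 1)), ∃ c ∈ tor J (finSupp R (F j \ F (j + 1)) (K j)), π j c = k

lemma Stage.inj {J : Ideal R} {i : ℕ} (h : Stage K π J i) {y : R}
    (hy : IsSMulRegular (K 0 ⧸ (J • (⊤ : Submodule R (K 0)))) y) :
    ∀ k ∈ tor J (K i), y • k = 0 → k = 0 := by
  obtain ⟨⟨f, hf, hk⟩, -⟩ := h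
  intro k hk' hyk
  rw [← hf] at hk'
  obtain ⟨m, rfl⟩ := hk'
  rw [← map_smul, ← LinearMap.mem_ker, hk] at hyk
  rw [← LinearMap.mem_ker, hk, ← Submodule.Quotient.mk_eq_zero]
  apply hy
  show y • Submodule.Quotient.mk m = y • 0
  rw [← Submodule.Quotient.mk_smul, smul_zero, Submodule.Quotient.mk_eq_zero]
  exact hyk

lemma Stage.div [IsNoetherianRing R] (D : Cous R F K π) {J : Ideal R} {i : ℕ}
    (h : Stage K π J i) {y : R}
    (hy : IsSMulRegular (K 0 ⧸ (J • (⊤ : Submodule R (K 0)))) y) (j : ℕ) (hj : i + 1 ≤ j) :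
    ∀ k ∈ tor J (K j), ∃ k1 ∈ tor J (K j), y • k1 = k := by
  have key : ∀ j ≥ i, (∀ c ∈ tor J (finSupp R (F j \ F (j + 1)) (K j)),
      ∃ c1 ∈ tor J (finSupp R (F j \ F (j + 1)) (K j)), y • c1 = c) →
      ∀ k ∈ tor J (K (j + 1)), ∃ k1 ∈ tor J (K (j + 1)), y • k1 = k := by
    intro j hj hc k hk
    obtain ⟨c, hcJ, rfl⟩ := h.2 j hj k hk
    obtain ⟨c1, hc1, rfl⟩ := hc c hcJ
    exact ⟨π j c1, map_tor _ hc1, (map_smul _ _ _).symm⟩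
  induction j, hj using Nat.le_induction with
  | base => exact key i le_rfl (D.C_bij i (h.inj hy)).2
  | succ j hj ih => exact key j (by omega) (C_div j ih)

lemma Stage.step [IsNoetherianRing R] (D : Cous R F K π) {J : Ideal R} {i : ℕ}
    (h : Stage K π J i) {y : R}
    (hy : IsSMulRegular (K 0 ⧸ (J • (⊤ : Submodule R (K 0)))) y) :
    Stage K π (J ⊔ Ideal.span {y}) (i + 1) := by
  have hdiv := h.div D hy
  have hinj := h.inj hy
  obtain ⟨hb1, hb2⟩ := D.C_bij i hinj
  obtain ⟨⟨f, hf, hk⟩, hs⟩ := h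
  refine ⟨?_, ?_⟩
  · let T := tor J (finSupp R (F i \ F (i + 1)) (K i))
    let Y : T →ₗ[R] T := LinearMap.lsmul R T y
    have hY : Function.Bijective Y := by
      constructor
      · intro a b hab
        apply Subtype.ext
        rw [← sub_eq_zero]
        refine hb1 _ (Submodule.sub_mem _ a.2 b.2) ?_
        rw [smul_sub, sub_eq_zero]
        exact congrArg Subtype.val hab
      · intro c
        obtain ⟨c1, hc1, h1⟩ := hb2 c.1 c.2
        exact ⟨⟨c1, hc1⟩, Subtype.ext h1⟩
    let e := LinearEquiv.ofBijective Y hY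
    have he : ∀ c : T, y • (e.symm c) = c := fun c => e.apply_symm_apply c
    have hfJ : ∀ m, f m ∈ tor J (K i) := fun m => hf ▸ ⟨m, rfl⟩
    let g : K 0 →ₗ[R] T := LinearMap.codRestrict T (D.io i ∘ₗ f) fun m =>
      map_tor (D.io i) (hfJ m)
    have hyg : ∀ m, y • (e.symm (g m)).1 = D.io i (f m) := fun m =>
      congrArg Subtype.val (he (g m))
    refine ⟨π i ∘ₗ T.subtype ∘ₗ e.symm.toLinearMap ∘ₗ g, ?_, ?_⟩
    · ext k'
      constructor
      · rintro ⟨m, rfl⟩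
        rw [mem_tor_sup]
        refine ⟨map_tor (π i) (e.symm (g m)).2, ?_⟩
        show y • π i (e.symm (g m)).1 = 0
        rw [← map_smul, hyg, D.io_ker]
        exact ⟨_, rfl⟩
      · intro hk'
        rw [mem_tor_sup] at hk'
        obtain ⟨c, hc, rfl⟩ := hs i le_rfl k' hk'.1
        have h1 := hk'.2
        rw [← map_smul, D.io_ker] at h1
        obtain ⟨k, hkc⟩ := h1
        have hkJ : k ∈ tor J (K i) := D.io_tor i (hkc ▸ Submodule.smul_mem _ _ hc)
        rw [← hf] at hkJ
        obtain ⟨m, rfl⟩ := hkJ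
        refine ⟨m, ?_⟩
        show π i (e.symm (g m)).1 = _
        congr 1
        have : e.symm (g m) = ⟨c, hc⟩ := by
          rw [LinearEquiv.symm_apply_eq]
          exact Subtype.ext hkc
        rw [this]
    · ext m
      rw [Submodule.sup_smul, Submodule.ideal_span_singleton_smul, LinearMap.mem_ker]
      show π i (e.symm (g m)).1 = 0 ↔ _
      rw [D.io_ker]
      constructor
      · rintro ⟨k, hk1⟩
        have hkJ : k ∈ tor J (K i) := D.io_tor i (hk1 ▸ (e.symm (g m)).2)
        rw [← hf] at hkJ
        obtain ⟨m1, rfl⟩ := hkJ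
        have : f (m - y • m1) = 0 := by
          apply D.io_inj i
          rw [map_sub, map_sub, map_smul, map_smul, hk1, hyg, sub_self, map_zero]
        rw [← LinearMap.mem_ker, hk] at this
        rw [Submodule.mem_sup]
        exact ⟨_, this, y • m1, Submodule.smul_mem_pointwise_smul _ _ _ trivial, by abel⟩
      · intro hm
        rw [Submodule.mem_sup] at hm
        obtain ⟨m0, hm0, m2, hm2, rfl⟩ := hm
        rw [← hk, LinearMap.mem_ker] at hm0
        obtain ⟨m1, -, rfl⟩ := hm2
        refine ⟨f m1, ?_⟩
        have hT : D.io i (f m1) ∈ T := map_tor _ (hfJ m1)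
        have : e.symm (g (m0 + y • m1)) = ⟨D.io i (f m1), hT⟩ := by
          rw [LinearEquiv.symm_apply_eq]
          apply Subtype.ext
          show D.io i (f (m0 + y • m1)) = y • D.io i (f m1)
          rw [map_add, hm0, zero_add, map_smul, map_smul]
        exact (congrArg Subtype.val this).symm
  · intro j hj k' hk'
    rw [mem_tor_sup] at hk'
    obtain ⟨c, hc, rfl⟩ := hs j (by omega) k' hk'.1
    have h1 := hk'.2
    rw [← map_smul, D.io_ker] at h1
    obtain ⟨k, hkc⟩ := h1
    have hkJ : k ∈ tor J (K j) := D.io_tor j (hkc ▸ Submodule.smul_mem _ _ hc)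
    obtain ⟨k1, hk1, rfl⟩ := hdiv j hj k hkJ
    refine ⟨c - D.io j k1, ?_, ?_⟩
    · rw [mem_tor_sup]
      refine ⟨Submodule.sub_mem _ hc (map_tor _ hk1), ?_⟩
      rw [smul_sub, ← hkc, map_smul, sub_self]
    · rw [map_sub, (D.io_ker j _).2 ⟨k1, rfl⟩, sub_zero]

lemma Stage.zero (D : Cous R F K π) : Stage K π ⊥ 0 := by
  have ht : ∀ (N : Type u) [AddCommGroup N] [Module R N] (x : N), x ∈ tor (⊥ : Ideal R) N := by
    intro N _ _ x a ha
    rw [(Submodule.mem_bot R).1 ha, zero_smul]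
  refine ⟨⟨LinearMap.id, ?_, ?_⟩, ?_⟩
  · rw [LinearMap.range_id]
    exact (eq_top_iff.2 fun x _ => ht _ x).symm
  · simp
  · intro j _ k _
    obtain ⟨c, hc⟩ := D.surj j k
    exact ⟨c, ht _ c, hc⟩

open RingTheory.Sequence in
lemma weak_snoc {M : Type u} [AddCommGroup M] [Module R M] (ys : List R) (y : R) :
    IsWeaklyRegular M (ys ++ [y]) ↔
      IsWeaklyRegular M ys ∧ IsSMulRegular (M ⧸ (Ideal.ofList ys • (⊤ : Submodule R M))) y := by
  rw [isWeaklyRegular_append_iff, isWeaklyRegular_singleton_iff]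

open RingTheory.Sequence in
lemma stage [IsNoetherianRing R] (D : Cous R F K π) (ys : List R)
    (h : IsWeaklyRegular (K 0) ys) : Stage K π (Ideal.ofList ys) ys.length := by
  induction ys using List.reverseRecOn with
  | nil => simpa using Stage.zero D
  | append_singleton ys y ih =>
    rw [weak_snoc] at h
    have := (ih h.1).step D h.2
    simpa [Ideal.ofList_singleton] using this

end Cous
end GG

namespace GG
open Cous (map_tor)

section Rel
variable {R : Type u} [CommRing R]

/-- injectivity relative to modules killed by `J` -/
def InjJ (J : Ideal R) (Q : Type u) [AddCommGroup Q] [Module R Q] : Prop :=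
  ∀ (A B : Type u) [AddCommGroup A] [Module R A] [AddCommGroup B] [Module R B] (f : A →ₗ[R] B),
    Function.Injective f → (∀ b, b ∈ tor J B) → ∀ g : A →ₗ[R] Q, ∃ h : B →ₗ[R] Q, ∀ x, h (f x) = g x

/-- Gorenstein injectivity over `R/J`, phrased with `R`-modules -/
def RelGI (J : Ideal R) (N : Type u) [AddCommGroup N] [Module R N] : Prop :=
  ∃ (X : ℤ → ModuleCat.{u} R) (d : ∀ n : ℤ, X n →ₗ[R] X (n + 1)),
    (∀ n, ∀ x : X n, x ∈ tor J (X n)) ∧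
    (∀ n, InjJ J (X n)) ∧
    (∀ n, LinearMap.range (d n) = LinearMap.ker (d (n + 1))) ∧
    (∀ (I : ModuleCat.{u} R), (∀ x : I, x ∈ tor J I) → InjJ J I →
      ∀ (n : ℤ) (φ : I →ₗ[R] X (n + 1)), (d (n + 1)).comp φ = 0 →
        ∃ ψ : I →ₗ[R] X n, (d n).comp ψ = φ) ∧
    ∃ g : N →ₗ[R] X 0, Function.Injective g ∧ LinearMap.range g = LinearMap.ker (d 0)

lemma tor_bot {N : Type u} [AddCommGroup N] [Module R N] (x : N) : x ∈ tor (⊥ : Ideal R) N := by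
  intro a ha
  rw [(Submodule.mem_bot R).1 ha, zero_smul]

lemma RelGI.of_gi {N : Type u} [AddCommGroup N] [Module R N] (h : IsGorensteinInjective R N) :
    RelGI (⊥ : Ideal R) (tor (⊥ : Ideal R) N) := by
  obtain ⟨X, d, h1, h2, h3, ⟨e⟩⟩ := h
  refine ⟨X, d, fun n x => tor_bot x, ?_, h2, ?_, ?_⟩
  · intro n A B _ _ _ _ f hf _ g
    exact (h1 n).out f hf g
  · intro I _ hI
    exact h3 I ⟨fun A B _ _ _ _ f hf g => hI A B f hf (fun b => tor_bot b) g⟩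
  · refine ⟨(LinearMap.ker (d 0)).subtype ∘ₗ e.toLinearMap ∘ₗ Submodule.subtype _, ?_, ?_⟩
    · exact (Submodule.subtype_injective _).comp (e.injective.comp (Submodule.subtype_injective _))
    · ext x
      constructor
      · rintro ⟨y, rfl⟩
        exact (e y.1).2
      · intro hx
        refine ⟨⟨e.symm ⟨x, hx⟩, tor_bot _⟩, ?_⟩
        simp

lemma InjJ.div {J : Ideal R} {Q : Type u} [AddCommGroup Q] [Module R Q] (hQ : InjJ J Q)
    (hk : ∀ x, x ∈ tor J Q) {y : R} (hy : ∀ r, y * r ∈ J → r ∈ J) (x : Q) : ∃ x', y • x' = x := by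
  obtain ⟨h, hh⟩ := hQ (R ⧸ J) (R ⧸ J) (LinearMap.lsmul R (R ⧸ J) y) (by
      refine (injective_iff_map_eq_zero (LinearMap.lsmul R (R ⧸ J) y)).2 ?_
      intro a ha
      obtain ⟨a, rfl⟩ := Ideal.Quotient.mk_surjective a
      rw [Ideal.Quotient.eq_zero_iff_mem]
      apply hy
      rw [← Ideal.Quotient.eq_zero_iff_mem]
      exact ha)
    (by
      intro b a ha
      obtain ⟨b, rfl⟩ := Ideal.Quotient.mk_surjective b
      have : Ideal.Quotient.mk J (a * b) = 0 := Ideal.Quotient.eq_zero_iff_mem.2 (J.mul_mem_right b ha)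
      exact this)
    (Submodule.liftQ J (LinearMap.toSpanSingleton R Q x) (fun a ha => hk x a ha))
  refine ⟨h (Submodule.Quotient.mk 1), ?_⟩
  have := hh (Submodule.Quotient.mk 1)
  rw [LinearMap.lsmul_apply, map_smul] at this
  rw [this]
  exact one_smul R x

lemma InjJ.tor {J J' : Ideal R} (hJ : J ≤ J') {Q : Type u} [AddCommGroup Q] [Module R Q]
    (hQ : InjJ J Q) : InjJ J' (tor J' Q) := by
  intro A B _ _ _ _ f hf hB g
  obtain ⟨h, hh⟩ := hQ A B f hf (fun b a ha => hB b a (hJ ha)) ((GG.tor J' Q).subtype ∘ₗ g)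
  exact ⟨h.codRestrict _ fun b => map_tor h (hB b), fun x => Subtype.ext (hh x)⟩

lemma enough (I : Type u) [AddCommGroup I] [Module R I] :
    ∃ (E : Type u) (_ : AddCommGroup E) (_ : Module R E) (i : I →ₗ[R] E),
      Function.Injective i ∧ Module.Injective R E := by
  obtain ⟨E, hE, f, hf⟩ := (CategoryTheory.EnoughInjectives.presentation (ModuleCat.of R I)).some
  refine ⟨E, inferInstance, inferInstance, f.hom, (ModuleCat.mono_iff_injective f).1 hf, ?_⟩
  exact Module.injective_module_of_injective_object R E

lemma RelGI.step {J : Ideal R} {y : R} (hy : ∀ r, y * r ∈ J → r ∈ J)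
    {C : Type u} [AddCommGroup C] [Module R C] (h : RelGI J (tor J C)) :
    RelGI (J ⊔ Ideal.span {y}) (tor (J ⊔ Ideal.span {y}) C) := by
  obtain ⟨X, d, h1, h2, h3, h4, g, hg, hg2⟩ := h
  have hJJ : J ≤ J ⊔ Ideal.span {y} := le_sup_left
  have hle : ∀ (N : Type u) [AddCommGroup N] [Module R N],
    tor (J ⊔ Ideal.span {y}) N ≤ tor J N := fun N _ _ x hx a ha => hx a (hJJ ha)
  let d' : ∀ n : ℤ, tor (J ⊔ Ideal.span {y}) (X n) →ₗ[R] tor (J ⊔ Ideal.span {y}) (X (n + 1)) :=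
    fun n => LinearMap.codRestrict _ ((d n) ∘ₗ Submodule.subtype _) fun x => map_tor (d n) x.2
  have hdd : ∀ n x, d (n + 1) (d n x) = 0 := by
    intro n x
    rw [← LinearMap.mem_ker, ← h3]
    exact ⟨x, rfl⟩
  refine ⟨fun n => ModuleCat.of R (tor (J ⊔ Ideal.span {y}) (X n)), d', ?_, ?_, ?_, ?_, ?_⟩
  · intro n x a ha
    exact Subtype.ext (x.2 a ha)
  · intro n
    exact (h2 n).tor hJJ
  · intro n
    ext x
    constructor
    · rintro ⟨w, rfl⟩
      exact Subtype.ext (hdd n w.1)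
    · intro hx
      have hx' : d (n + 1) x.1 = 0 := congrArg Subtype.val hx
      rw [← LinearMap.mem_ker, ← h3] at hx'
      obtain ⟨w, hw⟩ := hx'
      obtain ⟨m, rfl⟩ : ∃ m, n = m + 1 := ⟨n - 1, by ring⟩
      have h5 : d (m + 1) (y • w) = 0 := by
        rw [map_smul, hw]
        exact (mem_tor_sup.1 x.2).2
      rw [← LinearMap.mem_ker, ← h3] at h5
      obtain ⟨v, hv⟩ := h5
      obtain ⟨v', rfl⟩ := (h2 m).div (h1 m) hy v
      refine ⟨⟨w - d m v', mem_tor_sup.2 ⟨h1 _ _, ?_⟩⟩, Subtype.ext ?_⟩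
      · rw [smul_sub, ← map_smul, hv, sub_self]
      · show d (m + 1) (w - d m v') = x.1
        rw [map_sub, hdd, sub_zero, hw]
  · intro I hI1 hI2 n φ hφ
    obtain ⟨E0, _, _, i, hi, hE0⟩ := enough (R := R) I
    have hE : InjJ J (tor J E0) := InjJ.tor (J := ⊥) bot_le
      (fun A B _ _ _ _ f hf _ g => hE0.out f hf g)
    have hEk : ∀ x, x ∈ tor J (tor J E0) := fun x a ha => Subtype.ext (x.2 a ha)
    let i' : I →ₗ[R] tor (J ⊔ Ideal.span {y}) E0 := i.codRestrict _ fun x => map_tor i (hI1 x)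
    have hi' : Function.Injective i' := fun a b hab => hi (congrArg Subtype.val hab)
    obtain ⟨r, hr⟩ := hI2 I (tor (J ⊔ Ideal.span {y}) E0) i' hi'
      (fun x a ha => Subtype.ext (x.2 a ha)) LinearMap.id
    let inc : tor (J ⊔ Ideal.span {y}) E0 →ₗ[R] tor J E0 := Submodule.inclusion (hle E0)
    obtain ⟨Φ, hΦ⟩ := h2 (n + 1) _ _ inc (Submodule.inclusion_injective _) hEk
      (Submodule.subtype _ ∘ₗ φ ∘ₗ r)
    let Y : tor J E0 →ₗ[R] tor J E0 := LinearMap.lsmul R (tor J E0) y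
    have hφ' : ∀ x, d (n + 1) (φ x).1 = 0 := fun x => congrArg Subtype.val (LinearMap.congr_fun hφ x)
    have hker : LinearMap.ker Y ≤ LinearMap.ker (d (n + 1) ∘ₗ Φ) := by
      intro e he
      have he' : e.1 ∈ tor (J ⊔ Ideal.span {y}) E0 :=
        mem_tor_sup.2 ⟨e.2, congrArg Subtype.val he⟩
      have : Φ e = (φ (r ⟨e.1, he'⟩)).1 := hΦ ⟨e.1, he'⟩
      show d (n + 1) (Φ e) = 0
      rw [this, hφ']
    obtain ⟨Ψ, hΨ⟩ := h2 (n + 1 + 1) (tor J E0 ⧸ LinearMap.ker Y) (tor J E0)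
      (Submodule.liftQ _ Y le_rfl)
      (LinearMap.ker_eq_bot.1 (Submodule.ker_liftQ_eq_bot _ _ _ le_rfl)) hEk
      (Submodule.liftQ _ (d (n + 1) ∘ₗ Φ) hker)
    have hΨ' : ∀ e, Ψ (y • e) = d (n + 1) (Φ e) := fun e => hΨ (Submodule.Quotient.mk e)
    obtain ⟨Ψ', hΨ2⟩ := h4 (ModuleCat.of R (tor J E0)) hEk hE (n + 1) Ψ (by
      ext e
      obtain ⟨e', rfl⟩ := hE.div hEk hy e
      show d (n + 1 + 1) (Ψ (y • e')) = 0
      rw [hΨ', hdd])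
    obtain ⟨Θ, hΘ⟩ := h4 (ModuleCat.of R (tor J E0)) hEk hE n (Φ - Ψ' ∘ₗ Y) (by
      ext e
      show d (n + 1) (Φ e - Ψ' (y • e)) = 0
      rw [map_sub, ← hΨ', sub_eq_zero]
      exact (LinearMap.congr_fun hΨ2 (y • e)).symm)
    refine ⟨LinearMap.codRestrict _ (Θ ∘ₗ inc ∘ₗ i') fun x => map_tor (Θ ∘ₗ inc ∘ₗ i') (hI1 x), ?_⟩
    ext x
    show d n (Θ (inc (i' x))) = (φ x).1
    have h6 : d n (Θ (inc (i' x))) = Φ (inc (i' x)) - Ψ' (y • inc (i' x)) :=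
      LinearMap.congr_fun hΘ (inc (i' x))
    have h7 : y • inc (i' x) = 0 := by
      rw [← map_smul, ← map_smul, (mem_tor_sup.1 (hI1 x)).2, map_zero, map_zero]
    rw [h6, h7, map_zero, sub_zero, hΦ]
    show (φ (r (i' x))).1 = _
    rw [hr]; rfl
  · let inc : tor (J ⊔ Ideal.span {y}) C →ₗ[R] tor J C := Submodule.inclusion (hle C)
    have hk : ∀ c : tor (J ⊔ Ideal.span {y}) C, c ∈ tor (J ⊔ Ideal.span {y}) _ :=
      fun x a ha => Subtype.ext (x.2 a ha)
    refine ⟨LinearMap.codRestrict _ (g ∘ₗ inc) fun x => map_tor (g ∘ₗ inc) (hk x), ?_, ?_⟩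
    · intro a b hab
      exact Submodule.inclusion_injective (hle C) (hg (congrArg Subtype.val hab))
    · ext x
      constructor
      · rintro ⟨c, rfl⟩
        apply Subtype.ext
        show d 0 (g (inc c)) = 0
        rw [← LinearMap.mem_ker, ← hg2]
        exact ⟨_, rfl⟩
      · intro hx
        have hx' : d 0 x.1 = 0 := congrArg Subtype.val hx
        rw [← LinearMap.mem_ker, ← hg2] at hx'
        obtain ⟨c, hc⟩ := hx'
        have : c ∈ tor (J ⊔ Ideal.span {y}) (tor J C) := by
          intro a ha
          apply hg
          rw [map_smul, hc, map_zero]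
          exact x.2 a ha
        exact ⟨⟨c.1, fun a ha => congrArg Subtype.val (this a ha)⟩, Subtype.ext hc⟩

open RingTheory.Sequence in
lemma RelGI.of_regular {C : Type u} [AddCommGroup C] [Module R C] (h : IsGorensteinInjective R C)
    (ys : List R) (hys : IsWeaklyRegular R ys) :
    RelGI (Ideal.ofList ys) (tor (Ideal.ofList ys) C) := by
  induction ys using List.reverseRecOn with
  | nil => rw [Ideal.ofList_nil]; exact RelGI.of_gi h
  | append_singleton ys y ih =>
    rw [Cous.weak_snoc] at hys
    have := (ih hys.1).step (y := y) (by
      intro r hr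
      have h2 := @hys.2 (Submodule.Quotient.mk r) 0 (by
        show y • _ = y • _
        rw [smul_zero, ← Submodule.Quotient.mk_smul, Submodule.Quotient.mk_eq_zero]
        simpa using hr)
      rw [Submodule.Quotient.mk_eq_zero] at h2
      simpa using h2)
    rw [Ideal.ofList_append, Ideal.ofList_singleton]
    exact this

lemma RelGI.to_gi {J : Ideal R} {N : Type u} [AddCommGroup N] [Module R N] (h : RelGI J N)
    (N' : Type u) [AddCommGroup N'] [Module R N'] [Module (R ⧸ J) N'] [IsScalarTower R (R ⧸ J) N']
    (e : N' ≃ₗ[R] N) : IsGorensteinInjective (R ⧸ J) N' := by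
  obtain ⟨X, d, h1, h2, h3, h4, g, hg, hg2⟩ := h
  have hs : Function.Surjective (algebraMap R (R ⧸ J)) := Ideal.Quotient.mk_surjective
  have ht : ∀ n, Module.IsTorsionBySet R (X n) (J : Set R) := fun n x a => h1 n x a.1 a.2
  letI : ∀ n, Module (R ⧸ J) (X n) := fun n => (ht n).module
  haveI : ∀ n, IsScalarTower R (R ⧸ J) (X n) := fun n => (ht n).isScalarTower
  have hkill : ∀ (B : Type u) [AddCommGroup B] [Module R B] [Module (R ⧸ J) B]
      [IsScalarTower R (R ⧸ J) B] (b : B), b ∈ tor J B := by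
    intro B _ _ _ _ b a ha
    rw [← algebraMap_smul (R ⧸ J) a b]
    have : algebraMap R (R ⧸ J) a = 0 := Ideal.Quotient.eq_zero_iff_mem.2 ha
    rw [this, zero_smul]
  refine ⟨fun n => ModuleCat.of (R ⧸ J) (X n), fun n => (d n).extendScalarsOfSurjective hs,
    ?_, ?_, ?_, ?_⟩
  · intro n
    constructor
    intro A B _ _ _ _ f hf k
    letI : Module R A := Module.compHom A (algebraMap R (R ⧸ J))
    letI : Module R B := Module.compHom B (algebraMap R (R ⧸ J))
    haveI : IsScalarTower R (R ⧸ J) A := .of_algebraMap_smul fun _ _ => rfl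
    haveI : IsScalarTower R (R ⧸ J) B := .of_algebraMap_smul fun _ _ => rfl
    obtain ⟨q, hq⟩ := h2 n A B (f.restrictScalars R) hf (hkill B) (k.restrictScalars R)
    exact ⟨q.extendScalarsOfSurjective hs, hq⟩
  · intro n
    ext x
    exact SetLike.ext_iff.1 (h3 n) x
  · intro I hI n φ hφ
    letI : Module R I := Module.compHom I (algebraMap R (R ⧸ J))
    haveI : IsScalarTower R (R ⧸ J) I := .of_algebraMap_smul fun _ _ => rfl
    obtain ⟨ψ, hψ⟩ := h4 (ModuleCat.of R I) (hkill I) (by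
        intro A B _ _ _ _ f hf hB k
        have hA : ∀ x, x ∈ tor J A := fun x a ha => hf (by
          rw [map_smul, map_zero]; exact hB _ a ha)
        have tA : Module.IsTorsionBySet R A (J : Set R) := fun x a => hA x a.1 a.2
        have tB : Module.IsTorsionBySet R B (J : Set R) := fun x a => hB x a.1 a.2
        letI := tA.module
        letI := tB.module
        haveI : IsScalarTower R (R ⧸ J) A := tA.isScalarTower
        haveI : IsScalarTower R (R ⧸ J) B := tB.isScalarTower
        obtain ⟨q, hq⟩ := hI.out (f.extendScalarsOfSurjective hs) hf
          (k.extendScalarsOfSurjective hs)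
        exact ⟨q.restrictScalars R, hq⟩) n
      (LinearMap.restrictScalars R (M := I) (M₂ := X (n + 1)) φ) (by
        ext x
        exact LinearMap.congr_fun hφ x)
    refine ⟨LinearMap.extendScalarsOfSurjective (M := I) (N := X n) hs ψ, ?_⟩
    ext x
    exact LinearMap.congr_fun hψ x
  · let g' : N' →ₗ[R ⧸ J] X 0 := (g ∘ₗ e.toLinearMap).extendScalarsOfSurjective hs
    have hg' : ∀ x, g' x = g (e x) := fun x => rfl
    refine ⟨LinearEquiv.ofBijective (LinearMap.codRestrict
      (LinearMap.ker ((d 0).extendScalarsOfSurjective hs)) g' ?_) ⟨?_, ?_⟩⟩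
    · intro x
      show d 0 (g (e x)) = 0
      rw [← LinearMap.mem_ker, ← hg2]
      exact ⟨_, rfl⟩
    · intro a b hab
      exact e.injective (hg (congrArg Subtype.val hab))
    · rintro ⟨x, hx⟩
      have hx' : x ∈ LinearMap.ker (d 0) := hx
      rw [← hg2] at hx'
      obtain ⟨c, rfl⟩ := hx'
      exact ⟨e.symm c, Subtype.ext (by
        show g (e (e.symm c)) = g c
        rw [e.apply_symm_apply])⟩

end Rel
end GG

namespace GG

section LemA
variable {S : Type u} [CommRing S]

lemma inj_pt {E : Type u} [AddCommGroup E] [Module S E] (hE : Module.Injective S E)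
    (B : Type u) [AddCommGroup B] [Module S B] (c : B) (e : E)
    (h : ∀ u : S, u • c = 0 → u • e = 0) : ∃ f : B →ₗ[S] E, f c = e := by
  have hk : LinearMap.ker (LinearMap.toSpanSingleton S B c) ≤
      LinearMap.ker (LinearMap.toSpanSingleton S E e) := fun u hu => h u hu
  obtain ⟨f, hf⟩ := hE.out
    (Submodule.liftQ _ (LinearMap.toSpanSingleton S B c) le_rfl)
    (LinearMap.ker_eq_bot.1 (Submodule.ker_liftQ_eq_bot _ _ _ le_rfl))
    (Submodule.liftQ _ (LinearMap.toSpanSingleton S E e) hk)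
  refine ⟨f, ?_⟩
  have := hf (Submodule.Quotient.mk 1)
  rw [Submodule.liftQ_apply, Submodule.liftQ_apply] at this
  simpa using this

/-- `I`-power torsion -/
def Gam (I : Ideal S) {E : Type u} [AddCommGroup E] [Module S E] (x : E) : Prop :=
  ∃ t : ℕ, ∀ r ∈ I ^ t, r • x = 0

lemma Gam.mono {I J : Ideal S} (hIJ : I ≤ J) {E : Type u} [AddCommGroup E] [Module S E] {x : E}
    (h : Gam J x) : Gam I x := by
  obtain ⟨t, ht⟩ := h
  exact ⟨t, fun r hr => ht r (Ideal.pow_right_mono hIJ t hr)⟩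

lemma Gam.map {I : Ideal S} {E F : Type u} [AddCommGroup E] [Module S E] [AddCommGroup F]
    [Module S F] (f : E →ₗ[S] F) {x : E} (h : Gam I x) : Gam I (f x) := by
  obtain ⟨t, ht⟩ := h
  exact ⟨t, fun r hr => by rw [← map_smul, ht r hr, map_zero]⟩

lemma Gam.sub {I : Ideal S} {E : Type u} [AddCommGroup E] [Module S E] {x y : E} (hx : Gam I x)
    (hy : Gam I y) : Gam I (x - y) := by
  obtain ⟨t, ht⟩ := hx
  obtain ⟨t', ht'⟩ := hy
  refine ⟨t + t', fun r hr => ?_⟩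
  rw [smul_sub, ht r (Ideal.pow_le_pow_right (by omega) hr),
    ht' r (Ideal.pow_le_pow_right (by omega) hr), sub_zero]

lemma Gam.smul {I : Ideal S} {E : Type u} [AddCommGroup E] [Module S E] {x : E} (hx : Gam I x)
    (s : S) : Gam I (s • x) := by
  obtain ⟨t, ht⟩ := hx
  exact ⟨t, fun r hr => by rw [smul_comm, ht r hr, smul_zero]⟩

lemma Gam.sup {I : Ideal S} {a : S} {E : Type u} [AddCommGroup E] [Module S E] {x : E}
    (h : Gam I x) {k : ℕ} (hk : a ^ k • x = 0) : Gam (I ⊔ Ideal.span {a}) x := by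
  obtain ⟨t, ht⟩ := h
  refine ⟨t + k, fun r hr => ?_⟩
  have := Ideal.sup_pow_add_le_pow_sup_pow hr
  rw [Ideal.span_singleton_pow] at this
  obtain ⟨i, hi, j, hj, rfl⟩ := Submodule.mem_sup.1 this
  obtain ⟨c, rfl⟩ := Ideal.mem_span_singleton'.1 hj
  rw [add_smul, ht i hi, mul_smul, hk, smul_zero, zero_add]

lemma Gam.soc {I : Ideal S} {E : Type u} [AddCommGroup E] [Module S E] {x : E}
    (h : Gam I x) (hx : x ≠ 0) : ∃ r : S, r • x ≠ 0 ∧ ∀ a ∈ I, a • r • x = 0 := by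
  classical
  have h' : ∃ t : ℕ, ∀ r ∈ I ^ t, r • x = 0 := h
  have h1 := Nat.find_spec h'
  have h0 : Nat.find h' ≠ 0 := by
    intro h0
    rw [h0] at h1
    exact hx (by simpa using h1 1 (by simp))
  obtain ⟨t, ht⟩ := Nat.exists_eq_succ_of_ne_zero h0
  have h2 := Nat.find_min h' (m := t) (by omega)
  push Not at h2
  obtain ⟨r, hr, hrx⟩ := h2
  refine ⟨r, hrx, fun a ha => ?_⟩
  rw [← mul_smul]
  apply h1
  rw [ht, Nat.succ_eq_add_one, pow_succ, mul_comm a r]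
  exact Ideal.mul_mem_mul hr ha

lemma Gam.div [IsNoetherianRing S] {I : Ideal S} {E : Type u} [AddCommGroup E] [Module S E]
    (hE : Module.Injective S E) {w : E} (hw : Gam I w) (a : S) (k : ℕ) :
    ∃ (w' : E) (j : ℕ), Gam I w' ∧ a ^ (j + k) • w' = a ^ j • w := by
  obtain ⟨t, ht⟩ := hw
  -- the annihilators of powers of `a` stabilise
  obtain ⟨j, hj⟩ := monotone_stabilizes_iff_noetherian.2 (inferInstance : IsNoetherian S S)
    ⟨fun j => LinearMap.ker (LinearMap.lsmul S S (a ^ j)), monotone_nat_of_le_succ (by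
      intro j x hx
      have hx' : a ^ j * x = 0 := hx
      show a ^ (j + 1) * x = 0
      rw [pow_succ, mul_right_comm, hx', zero_mul])⟩
  have hj' : ∀ x : S, a ^ (j + k) * x = 0 → a ^ j * x = 0 := by
    intro x hx
    have := hj (j + k) (by omega)
    exact (SetLike.ext_iff.1 this x).2 hx
  obtain ⟨c, hc⟩ := Ideal.exists_pow_inf_eq_pow_smul I (Ideal.span {a ^ (j + k)})
  have hN := hc (c + t) (by omega)
  obtain ⟨f, hf⟩ := inj_pt hE (S ⧸ I ^ (c + t)) (Ideal.Quotient.mk _ (a ^ (j + k))) (a ^ j • w) (by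
    intro u hu
    have hu' : u * a ^ (j + k) ∈ I ^ (c + t) := by
      rw [← Ideal.Quotient.eq_zero_iff_mem, map_mul]
      exact hu
    have h1 : u * a ^ (j + k) ∈ (I ^ (c + t) • (⊤ : Submodule S S) ⊓ Ideal.span {a ^ (j + k)}) :=
      ⟨by simpa using hu', Ideal.mul_mem_left _ _ (Ideal.mem_span_singleton_self _)⟩
    rw [hN, Nat.add_sub_cancel_left] at h1
    have h2 : u * a ^ (j + k) ∈ I ^ t * Ideal.span {a ^ (j + k)} :=
      Submodule.smul_mono le_rfl inf_le_right h1
    obtain ⟨i, hi, h3⟩ := Ideal.mem_mul_span_singleton.1 h2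
    have h4 := hj' (u - i) (by rw [mul_sub, sub_eq_zero, mul_comm _ u, mul_comm _ i, h3])
    rw [mul_sub, sub_eq_zero] at h4
    rw [← mul_smul, mul_comm, h4, mul_smul, ht i hi, smul_zero])
  refine ⟨f (Ideal.Quotient.mk _ 1), j, ⟨c + t, fun r hr => ?_⟩, ?_⟩
  · rw [← map_smul]
    have : r • (Ideal.Quotient.mk (I ^ (c + t)) 1) = 0 := by
      rw [← Ideal.Quotient.mk_eq_mk, ← Submodule.Quotient.mk_smul, Submodule.Quotient.mk_eq_zero]
      simpa using hr
    rw [this, map_zero]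
  · rw [← map_smul, ← hf]
    congr 1
    rw [← Ideal.Quotient.mk_eq_mk, ← Submodule.Quotient.mk_smul, smul_eq_mul, mul_one]
    rfl

lemma Gam.exact [IsNoetherianRing S] (X : ℤ → ModuleCat.{u} S) (d : ∀ n : ℤ, X n →ₗ[S] X (n + 1))
    (h1 : ∀ n, Module.Injective S (X n))
    (h2 : ∀ n, LinearMap.range (d n) = LinearMap.ker (d (n + 1))) (I : Ideal S) :
    ∀ n, ∀ y : X (n + 1), Gam I y → d (n + 1) y = 0 → ∃ x : X n, Gam I x ∧ d n x = y := by
  have hdd : ∀ n x, d (n + 1) (d n x) = 0 := fun n x => by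
    have : d n x ∈ LinearMap.ker (d (n + 1)) := by rw [← h2]; exact ⟨x, rfl⟩
    exact this
  have hex : ∀ n, ∀ y : X (n + 1), d (n + 1) y = 0 → ∃ x : X n, d n x = y := fun n y hy => by
    have : y ∈ LinearMap.range (d n) := by rw [h2]; exact hy
    exact this
  have key : ∀ I0 : Ideal S, (∀ n, ∀ y : X (n + 1), Gam I0 y → d (n + 1) y = 0 →
      ∃ x : X n, Gam I0 x ∧ d n x = y) → (∀ n, ∀ y : X (n + 1), Gam (I0 ⊔ I) y → d (n + 1) y = 0 →
      ∃ x : X n, Gam (I0 ⊔ I) x ∧ d n x = y) := by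
    refine Submodule.fg_induction (R := S) (M := S) (motive := fun I _ => ∀ I0 : Ideal S, (∀ n, ∀ y : X (n + 1), Gam I0 y →
      d (n + 1) y = 0 →
      ∃ x : X n, Gam I0 x ∧ d n x = y) → (∀ n, ∀ y : X (n + 1), Gam (I0 ⊔ I) y → d (n + 1) y = 0 →
      ∃ x : X n, Gam (I0 ⊔ I) x ∧ d n x = y)) ?_ ?_ I (IsNoetherian.noetherian I)
    · intro a I0 hI n y hy hdy
      obtain ⟨m, rfl⟩ : ∃ m, n = m + 1 := ⟨n - 1, by ring⟩
      obtain ⟨x, hx, rfl⟩ := hI _ y (hy.mono le_sup_left) hdy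
      obtain ⟨k, hk⟩ := hy
      have hk' := hk (a ^ k) (Ideal.pow_mem_pow (Ideal.mem_sup_right
        (Ideal.mem_span_singleton_self a)) k)
      obtain ⟨w, hw, hwx⟩ := hI m (a ^ k • x) (hx.smul _) (by rw [map_smul, hk'])
      obtain ⟨w', j, hw', hj⟩ := Gam.div (h1 m) hw a k
      refine ⟨x - d m w', Gam.sup (k := j + k) (hx.sub (hw'.map _)) ?_, ?_⟩
      · rw [smul_sub, ← map_smul, hj, map_smul, hwx, ← mul_smul, pow_add, sub_self]
      · rw [map_sub, hdd, sub_zero]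
    · intro I1 I2 _ _ H1 H2 I0 h0
      rw [← sup_assoc]
      exact H2 _ (H1 _ h0)
  have := key ⊥ (fun n y _ hy => by
    obtain ⟨x, hx⟩ := hex n y hy
    refine ⟨x, ⟨1, fun r hr => ?_⟩, hx⟩
    rw [pow_one, Ideal.mem_bot] at hr
    rw [hr, zero_smul])
  rwa [bot_sup_eq] at this

/-- lifting of socles -/
lemma soc_lift (m : Ideal S) [hm : m.IsMaximal] {X Y : Type u} [AddCommGroup X] [Module S X]
    [AddCommGroup Y] [Module S Y] (f : X →ₗ[S] Y)
    (h : ∀ y ∈ tor m Y, ∃ x ∈ tor m X, f x = y) :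
    ∃ σ : tor m Y →ₗ[S] X, ∀ y, f (σ y) = y := by
  have tX : Module.IsTorsionBySet S (tor m X) (m : Set S) := fun x a => Subtype.ext (x.2 a.1 a.2)
  have tY : Module.IsTorsionBySet S (tor m Y) (m : Set S) := fun x a => Subtype.ext (x.2 a.1 a.2)
  letI := tX.module
  letI := tY.module
  haveI : IsScalarTower S (S ⧸ m) (tor m X) := tX.isScalarTower
  haveI : IsScalarTower S (S ⧸ m) (tor m Y) := tY.isScalarTower
  letI : Field (S ⧸ m) := Ideal.Quotient.field m
  have hs : Function.Surjective (algebraMap S (S ⧸ m)) := Ideal.Quotient.mk_surjective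
  let f0 : tor m X →ₗ[S] tor m Y := LinearMap.codRestrict _ (f ∘ₗ Submodule.subtype _)
    fun x a ha => by
      show a • f x.1 = 0
      rw [← map_smul, x.2 a ha, map_zero]
  let f1 : tor m X →ₗ[S ⧸ m] tor m Y := f0.extendScalarsOfSurjective hs
  obtain ⟨g, hg⟩ := LinearMap.exists_rightInverse_of_surjective f1 (by
    rw [LinearMap.range_eq_top]
    rintro ⟨y, hy⟩
    obtain ⟨x, hx, rfl⟩ := h y hy
    exact ⟨⟨x, hx⟩, rfl⟩)
  refine ⟨Submodule.subtype _ ∘ₗ g.restrictScalars S, fun y => ?_⟩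
  exact congrArg Subtype.val (LinearMap.congr_fun hg y)

lemma lemA [IsNoetherianRing S] (X : ℤ → ModuleCat.{u} S) (d : ∀ n : ℤ, X n →ₗ[S] X (n + 1))
    (h1 : ∀ n, Module.Injective S (X n))
    (h2 : ∀ n, LinearMap.range (d n) = LinearMap.ker (d (n + 1)))
    (m : Ideal S) [hm : m.IsMaximal] (z : S) (hz : ∀ u, u * z = 0 ↔ u ∈ m) (s : S) (hs : s ∈ m)
    (n : ℤ) (hdiv : ∀ g : X (n + 1 + 1), d (n + 1 + 1) g = 0 → ∃ g', d (n + 1 + 1) g' = 0 ∧ s • g' = g)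
    (g : X (n + 1 + 1)) (hg : d (n + 1 + 1) g = 0) (hmg : ∀ a ∈ m, a • g = 0) : g = 0 := by
  have hdd : ∀ n x, d (n + 1) (d n x) = 0 := fun n x => by
    have : d n x ∈ LinearMap.ker (d (n + 1)) := by rw [← h2]; exact ⟨x, rfl⟩
    exact this
  have hex : ∀ n, ∀ y : X (n + 1), d (n + 1) y = 0 → ∃ x : X n, d n x = y := fun n y hy => by
    have : y ∈ LinearMap.range (d n) := by rw [h2]; exact hy
    exact this
  have hzm : ∀ a ∈ m, a * z = 0 := fun a ha => (hz a).2 ha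
  have soc : ∀ y ∈ tor m (X (n + 1)), ∃ y', z • y' = y := by
    intro y hy
    obtain ⟨f, hf⟩ := inj_pt (h1 (n + 1)) S z y (fun u hu => hy u ((hz u).1 hu))
    exact ⟨f 1, by rw [← map_smul, smul_eq_mul, mul_one, hf]⟩
  have hsoc : ∀ y ∈ tor m (X (n + 1)), ∃ x ∈ tor m (X n), d n x = y := by
    intro y hy
    obtain ⟨y1, rfl⟩ := soc y hy
    obtain ⟨g', hg', hsg⟩ := hdiv (d (n + 1) y1) (hdd _ _)
    obtain ⟨y2, rfl⟩ := hex _ g' hg'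
    obtain ⟨x, hx⟩ := hex n (y1 - s • y2) (by rw [map_sub, map_smul, hsg, sub_self])
    refine ⟨z • x, ?_, ?_⟩
    · intro a ha
      rw [← mul_smul, hzm a ha, zero_smul]
    · rw [map_smul, hx, smul_sub, ← mul_smul z s, mul_comm, hzm s hs, zero_smul, sub_zero]
  obtain ⟨σ, hσ⟩ := soc_lift m (d n) hsoc
  obtain ⟨τ, hτ⟩ := (h1 n).out (tor m (X (n + 1))).subtype (Submodule.subtype_injective _) σ
  have hid : ∀ y ∈ tor m (X (n + 1)), d n (τ y) = y := by
    intro y hy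
    have := hτ ⟨y, hy⟩
    rw [Submodule.subtype_apply] at this
    rw [this, hσ]
  let T : Submodule S (X (n + 1)) :=
    { carrier := {y | Gam m y}
      add_mem' := by
        intro a b ha hb
        have : Gam m (a - (-1 : S) • b) := Gam.sub ha (Gam.smul hb _)
        simpa using this
      zero_mem' := ⟨0, fun r _ => smul_zero r⟩
      smul_mem' := fun c x hx => Gam.smul hx c }
  let θ : T →ₗ[S] X (n + 1) := d n ∘ₗ τ ∘ₗ T.subtype
  have hinj : ∀ f : X (n + 1) →ₗ[S] X (n + 1), (∀ y ∈ tor m (X (n + 1)), f y = y) →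
      ∀ y, Gam m y → f y = 0 → y = 0 := by
    intro f hf y hy hfy
    by_contra hne
    obtain ⟨r, hr, hr2⟩ := hy.soc hne
    apply hr
    rw [← hf _ hr2, map_smul, hfy, smul_zero]
  obtain ⟨ρ, hρ⟩ := (h1 (n + 1)).out θ (by
    refine (injective_iff_map_eq_zero θ).2 ?_
    rintro ⟨y, hy⟩ h
    exact Subtype.ext (hinj (d n ∘ₗ τ) hid y hy h)) T.subtype
  have hρ' : ∀ y, Gam m y → ρ (d n (τ y)) = y := fun y hy => hρ ⟨y, hy⟩
  have hsurj : ∀ y, Gam m y → d n (τ (ρ y)) = y := by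
    intro y hy
    have hρy : Gam m (ρ y) := hy.map ρ
    have h3 : ρ (d n (τ (ρ y)) - y) = 0 := by rw [map_sub, hρ' _ hρy, sub_self]
    have := hinj ρ (fun x hx => by
      have h4 := hρ' x ⟨1, fun r hr => hx r (by simpa using hr)⟩
      rwa [hid x hx] at h4) _ (((hρy.map τ).map (d n)).sub hy) h3
    exact sub_eq_zero.1 this
  obtain ⟨y, hy, rfl⟩ := Gam.exact X d h1 h2 m (n + 1) g ⟨1, fun r hr => hmg r (by simpa using hr)⟩ hg
  rw [← hsurj y hy, hdd]

lemma IsGorensteinInjective.soc_zero [IsNoetherianRing S] {N : Type u} [AddCommGroup N] [Module S N]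
    (hN : IsGorensteinInjective S N) (m : Ideal S) [hm : m.IsMaximal] (z : S)
    (hz : ∀ u, u * z = 0 ↔ u ∈ m) (s : S) (hs : s ∈ m) (hdiv : ∀ g : N, ∃ g' : N, s • g' = g)
    (g : N) (hmg : ∀ a ∈ m, a • g = 0) : g = 0 := by
  obtain ⟨X, d, h1, h2, h3, ⟨e⟩⟩ := hN
  obtain ⟨n, hn⟩ : ∃ n : ℤ, (0 : ℤ) = n + 1 + 1 := ⟨-2, by ring⟩
  rw [hn] at e
  apply e.injective
  rw [map_zero]
  apply Subtype.ext
  refine lemA X d h1 h2 m z hz s hs n ?_ (e g).1 (e g).2 ?_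
  · intro x hx
    obtain ⟨g', hg'⟩ := hdiv (e.symm ⟨x, hx⟩)
    refine ⟨(e g').1, (e g').2, ?_⟩
    have : s • e g' = ⟨x, hx⟩ := by rw [← map_smul, hg', e.apply_symm_apply]
    exact congrArg Subtype.val this
  · intro a ha
    have : a • e g = 0 := by rw [← map_smul, hmg a ha, map_zero]
    exact congrArg Subtype.val this

end LemA
end GG

namespace GG
open RingTheory.Sequence

lemma avoid {R : Type u} [CommRing R] [IsNoetherianRing R] (N : Type u) [AddCommGroup N]
    [Module R N] [Module.Finite R N] (m : Ideal R) [hm : m.IsMaximal]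
    (h : ∀ x : N, (∀ a ∈ m, a • x = 0) → x = 0) : ∃ s ∈ m, IsSMulRegular N s := by
  classical
  by_contra hcon
  push Not at hcon
  have hsub : (m : Set R) ⊆ ⋃ p ∈ ((associatedPrimes.finite R N).toFinset : Set (Ideal R)),
      ((id p : Ideal R) : Set R) := by
    intro s hs
    have : s ∈ ⋃ p ∈ associatedPrimes R N, (p : Set R) := by
      rw [biUnion_associatedPrimes_eq_compl_regular R N]
      exact hcon s hs
    simpa using this
  obtain ⟨p, hp, hmp⟩ := (Ideal.subset_union_prime (s := (associatedPrimes.finite R N).toFinset)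
    (f := id) ⊥ ⊥ (by
      intro i hi _ _
      rw [Set.Finite.mem_toFinset] at hi
      exact hi.isPrime)).1 hsub
  rw [Set.Finite.mem_toFinset] at hp
  have hp' : IsAssociatedPrime p N := hp
  obtain ⟨hpp, x, hx⟩ := isAssociatedPrime_iff.1 hp'
  have hx0 : x = 0 := by
    apply h
    intro a ha
    have ha' : a ∈ p := hmp ha
    rw [hx, Submodule.mem_colon_singleton] at ha'
    simpa using ha'
  apply hpp.ne_top
  rw [hx, hx0, Ideal.eq_top_iff_one, Submodule.mem_colon_singleton]
  simp

lemma top_ne {R : Type u} [CommRing R] (N : Type u) [AddCommGroup N]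
    [Module R N] [Module.Finite R N] (m : PrimeSpectrum R) (hm : m ∈ Module.support R N)
    (I : Ideal R) (hI : I ≤ m.asIdeal) : (⊤ : Submodule R N) ≠ I • ⊤ := by
  intro h
  have : m ∈ Module.support R (N ⧸ (I • ⊤ : Submodule R N)) := by
    rw [Module.support_quotient]
    exact ⟨hm, hI⟩
  obtain ⟨x, hx⟩ := Module.mem_support_iff'.1 this
  obtain ⟨a, rfl⟩ := Submodule.Quotient.mk_surjective _ x
  refine hx 1 (fun h1 => m.2.ne_top ((Ideal.eq_top_iff_one _).2 h1)) ?_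
  rw [one_smul, Submodule.Quotient.mk_eq_zero, ← h]
  trivial

namespace Cous
variable {R : Type u} [CommRing R] {F : ℕ → Set (PrimeSpectrum R)} {K : ℕ → ModuleCat.{u} R}
    {π : ∀ j, finSupp R (F j \ F (j + 1)) (K j) →ₗ[R] K (j + 1)}

lemma nosoc (D : Cous R F K π) {J : Ideal R} {i : ℕ} (h : Stage K π J i) (m : PrimeSpectrum R)
    (hmax : m.asIdeal.IsMaximal) (hm : m ∈ F (i + 1))
    (x : K 0 ⧸ (J • (⊤ : Submodule R (K 0)))) (hx : ∀ a ∈ m.asIdeal, a • x = 0) : x = 0 := by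
  obtain ⟨⟨f, hf, hk⟩, -⟩ := h
  obtain ⟨a, rfl⟩ := Submodule.Quotient.mk_surjective _ x
  have hfa : ∀ r ∈ m.asIdeal, r • f a = 0 := by
    intro r hr
    have := hx r hr
    rw [← Submodule.Quotient.mk_smul, Submodule.Quotient.mk_eq_zero, ← hk] at this
    rw [← map_smul]
    exact this
  rw [Submodule.Quotient.mk_eq_zero, ← hk, LinearMap.mem_ker]
  apply D.io_inj i
  rw [map_zero]
  apply Subtype.ext
  funext p
  by_contra hp
  have hmp : m.asIdeal ≤ p.1.asIdeal := by
    intro r hr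
    by_contra hrp
    apply hp
    apply loc_inj p.1.asIdeal hrp
    have h1 : r • D.io i (f a) = 0 := by rw [← map_smul, hfa r hr, map_zero]
    exact congrFun (congrArg Subtype.val h1) p
  have : m = p.1 := PrimeSpectrum.ext (hmax.eq_of_le p.1.2.ne_top hmp)
  exact p.2.2 (this ▸ hm)

lemma extend [IsNoetherianRing R] (D : Cous R F K π) [Module.Finite R (K 0)]
    (hF : ∀ i, F (i + 1) ⊆ F i) (xs : List R) (hxs : IsWeaklyRegular (K 0) xs)
    (m : PrimeSpectrum R) (hmax : m.asIdeal.IsMaximal) (hxm : Ideal.ofList xs ≤ m.asIdeal) (j : ℕ)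
    (hj : xs.length ≤ j) : m ∈ F j → ∃ ys : List R, IsWeaklyRegular (K 0) ys ∧ ys.length = j ∧
      Ideal.ofList ys ≤ m.asIdeal ∧ Ideal.ofList xs ≤ Ideal.ofList ys := by
  induction j, hj using Nat.le_induction with
  | base => exact fun _ => ⟨xs, hxs, rfl, hxm, le_rfl⟩
  | succ j hj ih =>
    intro hm
    obtain ⟨ys, h1, rfl, h3, h4⟩ := ih (hF j hm)
    obtain ⟨s, hs, hreg⟩ := avoid _ m.asIdeal (nosoc D (D.stage ys h1) m hmax hm)
    refine ⟨ys ++ [s], (weak_snoc ys s).2 ⟨h1, hreg⟩, by simp, ?_, ?_⟩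
    · rw [Ideal.ofList_append, Ideal.ofList_singleton]
      exact sup_le h3 ((Ideal.span_singleton_le_iff_mem _).2 hs)
    · rw [Ideal.ofList_append]
      exact h4.trans le_sup_left

lemma find_soc [IsNoetherianRing R] (D : Cous R F K π) [Module.Finite R (K 0)] {I : Ideal R} {j : ℕ}
    (h : Stage K π I j) (m : PrimeSpectrum R) (hm : m ∈ F j \ F (j + 1)) (hI : I ≤ m.asIdeal)
    (hsupp : m ∈ Module.support R (K 0)) :
    ∃ g ∈ tor I (finSupp R (F j \ F (j + 1)) (K j)), g ≠ 0 ∧ ∀ a ∈ m.asIdeal, a • g = 0 := by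
  classical
  have h1 : m ∈ Module.support R (K 0 ⧸ (I • (⊤ : Submodule R (K 0)))) := by
    rw [Module.support_quotient]
    exact ⟨hsupp, hI⟩
  obtain ⟨x, hx⟩ := Module.mem_support_iff'.1 h1
  obtain ⟨a, rfl⟩ := Submodule.Quotient.mk_surjective _ x
  obtain ⟨⟨f, hf, hk⟩, -⟩ := h
  have hfa : f a ∈ tor I (K j) := by rw [← hf]; exact ⟨a, rfl⟩
  set v := LocalizedModule.mkLinearMap m.asIdeal.primeCompl (K j) (f a) with hv
  have hv0 : v ≠ 0 := by
    intro h0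
    obtain ⟨s, hs, hsk⟩ := (loc_zero m.asIdeal (f a)).1 h0
    refine hx s hs ?_
    rw [← Submodule.Quotient.mk_smul, Submodule.Quotient.mk_eq_zero, ← hk, LinearMap.mem_ker,
      map_smul, hsk]
  have hvI : v ∈ tor I (LocalizedModule m.asIdeal.primeCompl (K j)) := map_tor _ hfa
  obtain ⟨t, ht⟩ : ∃ t : ℕ, m.asIdeal ^ t ≤
      LinearMap.ker (LinearMap.toSpanSingleton R (LocalizedModule m.asIdeal.primeCompl (K j)) v) :=
    Ideal.exists_pow_le_of_le_radical_of_fg (fun b hb => by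
      obtain ⟨n, hn⟩ := D.tors j hm hb v
      exact ⟨n, hn⟩) (IsNoetherian.noetherian _)
  obtain ⟨r, hr, hr2⟩ := Gam.soc (I := m.asIdeal) (x := v) ⟨t, fun b hb => ht hb⟩ hv0
  let σ := LinearMap.single R
    (fun p : ↥(F j \ F (j + 1)) => LocalizedModule p.1.asIdeal.primeCompl (K j)) ⟨m, hm⟩
  have hσ : ∀ w, σ w ∈ finSupp R (F j \ F (j + 1)) (K j) := by
    intro w
    refine (Set.finite_singleton (⟨m, hm⟩ : ↥(F j \ F (j + 1)))).subset ?_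
    intro p hp
    by_contra hne
    exact hp (Pi.single_eq_of_ne hne _)
  refine ⟨⟨σ (r • v), hσ _⟩, ?_, ?_, ?_⟩
  · intro b hb
    apply Subtype.ext
    show b • σ (r • v) = 0
    rw [← map_smul, smul_comm, hvI b hb, smul_zero, map_zero]
  · intro h0
    apply hr
    have h2 : σ (r • v) = 0 := congrArg Subtype.val h0
    have h3 : σ (r • v) ⟨m, hm⟩ = 0 := by rw [h2]; rfl
    have h4 : σ (r • v) ⟨m, hm⟩ = r • v := Pi.single_eq_same _ _
    rw [← h4, h3]
  · intro b hb
    apply Subtype.ext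
    show b • σ (r • v) = 0
    rw [← map_smul, hr2 b hb, map_zero]

end Cous

lemma exists_level {R : Type u} [CommRing R] [IsNoetherianRing R] (M : Type u) [AddCommGroup M]
    [Module R M] (m : PrimeSpectrum R) (n : ℕ) (hm : m ∈ heightFiltration R M n) :
    ∃ j, n ≤ j ∧ m ∈ heightFiltration R M j \ heightFiltration R M (j + 1) := by
  obtain ⟨h1, h2⟩ := hm
  have h3 : htM R M m < ⊤ := by
    rw [htM_of_mem h1]
    refine (Order.height_le_height_apply_of_strictMono (Subtype.val : Module.support R M → _)
      (fun _ _ h => h) ⟨m, h1⟩).trans_lt ?_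
    rw [← PrimeSpectrum.height_eq_orderHeight]
    exact Ideal.height_lt_top_of_isPrime
  obtain ⟨j, hj⟩ := ENat.ne_top_iff_exists.1 h3.ne
  refine ⟨j, ?_, ⟨h1, hj.le⟩, ?_⟩
  · rw [← hj] at h2
    exact_mod_cast h2
  · rintro ⟨-, h4⟩
    rw [← hj] at h4
    have : j + 1 ≤ j := by exact_mod_cast h4
    omega

lemma soc_abs {R : Type u} [CommRing R] [IsNoetherianRing R] {C : Type u} [AddCommGroup C]
    [Module R C] {J : Ideal R} (h : RelGI J (tor J C)) (m : Ideal R) [hm0 : m.IsMaximal]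
    (hJm : J ≤ m) (b : R) (hb0 : b ∉ J) (hb' : ∀ a ∈ m, a * b ∈ J) (s : R) (hs : s ∈ m)
    (hdiv : ∀ c ∈ tor J C, ∃ c1 ∈ tor J C, s • c1 = c) (g : C) (hgJ : g ∈ tor J C)
    (hmg : ∀ a ∈ m, a • g = 0) : g = 0 := by
  have tN : Module.IsTorsionBySet R (tor J C) (J : Set R) := fun x a => Subtype.ext (x.2 a.1 a.2)
  letI := tN.module
  haveI : IsScalarTower R (R ⧸ J) (tor J C) := tN.isScalarTower
  have hN : IsGorensteinInjective (R ⧸ J) (tor J C) := h.to_gi _ (LinearEquiv.refl R _)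
  have hsm : ∀ (a : R) (x : tor J C), Ideal.Quotient.mk J a • x = a • x := fun a x =>
    algebraMap_smul (R ⧸ J) a x
  have hmm : (Ideal.map (Ideal.Quotient.mk J) m).IsMaximal := by
    refine Ideal.IsMaximal.map_of_surjective_of_ker_le Ideal.Quotient.mk_surjective ?_
    rw [Ideal.mk_ker]
    exact hJm
  have hmem : ∀ a, Ideal.Quotient.mk J a ∈ Ideal.map (Ideal.Quotient.mk J) m ↔ a ∈ m := by
    intro a
    rw [Ideal.mem_quotient_iff_mem hJm]
  have := hN.soc_zero (Ideal.map (Ideal.Quotient.mk J) m) (Ideal.Quotient.mk J b) (by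
      intro u
      obtain ⟨u, rfl⟩ := Ideal.Quotient.mk_surjective u
      rw [← map_mul, Ideal.Quotient.eq_zero_iff_mem, hmem]
      refine ⟨fun hu => ?_, hb' u⟩
      by_contra hum
      obtain ⟨c, i, hi, hc⟩ := hm0.exists_inv hum
      apply hb0
      have : b = c * (u * b) + i * b := by
        rw [← mul_assoc, ← add_mul, hc, one_mul]
      rw [this]
      exact add_mem (Ideal.mul_mem_left _ _ hu) (hb' i hi))
    (Ideal.Quotient.mk J s) ((hmem s).2 hs) (by
      rintro ⟨c, hc⟩
      obtain ⟨c1, hc1, h1⟩ := hdiv c hc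
      refine ⟨⟨c1, hc1⟩, ?_⟩
      rw [hsm]
      exact Subtype.ext h1) ⟨g, hgJ⟩ (by
      intro a ha
      obtain ⟨a, rfl⟩ := Ideal.Quotient.mk_surjective a
      rw [hsm]
      exact Subtype.ext (hmg a ((hmem a).1 ha)))
  exact congrArg Subtype.val this

lemma equiv_of {R : Type u} [CommRing R] {A B : Type u} [AddCommGroup A] [Module R A]
    [AddCommGroup B] [Module R B] {P : Submodule R A} (f : A →ₗ[R] B) (h : LinearMap.ker f = P)
    (hs : Function.Surjective f) : Nonempty ((A ⧸ P) ≃ₗ[R] B) := by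
  subst h
  exact ⟨f.quotKerEquivOfSurjective hs⟩

lemma Cous.quot_equiv {R : Type u} [CommRing R] {F : ℕ → Set (PrimeSpectrum R)}
    {K : ℕ → ModuleCat.{u} R} {π : ∀ j, finSupp R (F j \ F (j + 1)) (K j) →ₗ[R] K (j + 1)}
    (D : Cous R F K π) {J : Ideal R} {i : ℕ} (h : Cous.Stage K π J i)
    (hz : ∀ k ∈ tor J (K (i + 1)), k = 0) :
    Nonempty ((K 0 ⧸ (J • (⊤ : Submodule R (K 0)))) ≃ₗ[R]
      tor J (finSupp R (F i \ F (i + 1)) (K i))) := by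
  obtain ⟨⟨f, hf, hk⟩, -⟩ := h
  have hmem : ∀ a, (D.io i ∘ₗ f) a ∈ tor J (finSupp R (F i \ F (i + 1)) (K i)) := fun a =>
    Cous.map_tor (D.io i) (x := f a) (by rw [← hf]; exact ⟨a, rfl⟩)
  refine equiv_of (R := R) (A := K 0) (B := tor J (finSupp R (F i \ F (i + 1)) (K i)))
    (LinearMap.codRestrict _ (D.io i ∘ₗ f) hmem) ?_ ?_
  · rw [LinearMap.ker_codRestrict, LinearMap.ker_comp, LinearMap.ker_eq_bot.2 (D.io_inj i),
      Submodule.comap_bot, hk]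
  · rintro ⟨c, hc⟩
    obtain ⟨k, hkc⟩ := (D.io_ker i c).1 (hz _ (Cous.map_tor _ hc))
    have hk' : k ∈ tor J (K i) := D.io_tor i (by rw [hkc]; exact hc)
    rw [← hf] at hk'
    obtain ⟨a, rfl⟩ := hk'
    exact ⟨a, Subtype.ext hkc⟩

lemma main_zero {R : Type u} [CommRing R] [IsNoetherianRing R]
    (M : ModuleCat.{u} R) (hM : IsGGorenstein R M) (xs : List R)
    (hxM : IsWeaklyRegular M xs) (hxR : IsWeaklyRegular R xs)
    (hmax : ∀ r : R, ¬ (IsRegular M (xs ++ [r]) ∧ IsRegular R (xs ++ [r])))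
    {π} (D : Cous R (heightFiltration R M) (cousinK R (heightFiltration R M) M) π) :
    ∀ k ∈ tor (Ideal.ofList xs) (cousinK R (heightFiltration R M) M (xs.length + 1)), k = 0 := by
  intro k hk
  by_contra hk0
  obtain ⟨-, hfin, hres⟩ := hM
  have hGI := hres.2.2.2
  haveI : Module.Finite R (cousinK R (heightFiltration R M) M 0) := hfin
  have hst := D.stage xs hxM
  have hF : ∀ i, heightFiltration R M (i + 1) ⊆ heightFiltration R M i := by
    rintro i p ⟨h1, h2⟩
    refine ⟨h1, le_trans ?_ h2⟩
    exact_mod_cast Nat.le_succ i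
  -- the maximal ideal
  obtain ⟨m0, hm0, hle⟩ := Ideal.exists_le_maximal (LinearMap.ker (LinearMap.toSpanSingleton R _ k))
    (by
      intro h
      rw [Ideal.eq_top_iff_one] at h
      have h' : (1 : R) • k = 0 := h
      exact hk0 (by rwa [one_smul] at h'))
  let m : PrimeSpectrum R := ⟨m0, hm0.isPrime⟩
  have hmF : m ∈ heightFiltration R M (xs.length + 1) := by
    by_contra hcon
    obtain ⟨r, hr, hrk⟩ := D.supp _ m hcon k
    exact hr (hle hrk)
  have hJm : Ideal.ofList xs ≤ m.asIdeal := fun a ha => hle (hk a ha)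
  have hns := D.nosoc hst m hm0 hmF
  obtain ⟨s, hs, hsreg⟩ := avoid _ m.asIdeal hns
  -- a socle element of R/J
  obtain ⟨b, hb0, hb⟩ : ∃ b : R ⧸ (Ideal.ofList xs • (⊤ : Submodule R R)), b ≠ 0 ∧
      ∀ a ∈ m.asIdeal, a • b = 0 := by
    by_contra hcon
    push Not at hcon
    obtain ⟨r, hr, hreg⟩ := avoid ((cousinK R (heightFiltration R M) M 0 ⧸
        (Ideal.ofList xs • (⊤ : Submodule R (cousinK R (heightFiltration R M) M 0)))) ×
        (R ⧸ (Ideal.ofList xs • (⊤ : Submodule R R)))) m.asIdeal (by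
      rintro ⟨x, b⟩ hxb
      have h1 : x = 0 := hns x fun a ha => congrArg Prod.fst (hxb a ha)
      have h2 : b = 0 := by
        by_contra hb0
        obtain ⟨a, ha, hab⟩ := hcon b hb0
        exact hab (congrArg Prod.snd (hxb a ha))
      rw [h1, h2]; rfl)
    have hle' : Ideal.ofList (xs ++ [r]) ≤ m.asIdeal := by
      rw [Ideal.ofList_append, Ideal.ofList_singleton]
      exact sup_le hJm ((Ideal.span_singleton_le_iff_mem _).2 hr)
    refine hmax r ⟨⟨(Cous.weak_snoc xs r).2 ⟨hxM, ?_⟩, top_ne M m hmF.1 _ hle'⟩,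
      ⟨(Cous.weak_snoc xs r).2 ⟨hxR, ?_⟩, top_ne R m ?_ _ hle'⟩⟩
    · intro x y hxy
      exact congrArg Prod.fst (@hreg (x, 0) (y, 0) (Prod.ext hxy rfl))
    · intro x y hxy
      exact congrArg Prod.snd (@hreg (0, x) (0, y) (Prod.ext rfl hxy))
    · rw [Module.mem_support_iff_of_finite]
      intro x hx
      have := Module.mem_annihilator.1 hx 1
      rw [smul_eq_mul, mul_one] at this
      rw [this]; exact zero_mem _
  obtain ⟨b, rfl⟩ := Submodule.Quotient.mk_surjective _ b
  rw [Ne, Submodule.Quotient.mk_eq_zero, smul_eq_mul, Ideal.mul_top] at hb0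
  have hb' : ∀ a ∈ m.asIdeal, a * b ∈ Ideal.ofList xs := by
    intro a ha
    have := hb a ha
    rwa [← Submodule.Quotient.mk_smul, Submodule.Quotient.mk_eq_zero, smul_eq_mul, smul_eq_mul,
      Ideal.mul_top] at this
  -- the level of m
  obtain ⟨j, hj, hmj⟩ := exists_level M m _ hmF
  obtain ⟨ys, hys, rfl, hym, hxy⟩ := D.extend hF xs hxM m hm0 hJm j (by omega) hmj.1
  obtain ⟨g, hg, hg0, hmg⟩ := D.find_soc (D.stage ys hys) m hmj hym hmF.1
  have hgJ : g ∈ tor (Ideal.ofList xs) _ := fun a ha => hg a (hxy ha)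
  have hdiv := Cous.C_div (F := heightFiltration R M) ys.length (hst.div D hsreg ys.length hj)
  exact hg0 (soc_abs (RelGI.of_regular (hGI ys.length) xs hxR) m.asIdeal hJm b hb0 hb' s hs hdiv
    g hgJ hmg)

lemma main_gi {R : Type u} [CommRing R] [IsNoetherianRing R]
    (M : ModuleCat.{u} R) (hM : IsGGorenstein R M) (xs : List R)
    (hxM : IsWeaklyRegular M xs) (hxR : IsWeaklyRegular R xs)
    (hmax : ∀ r : R, ¬ (IsRegular M (xs ++ [r]) ∧ IsRegular R (xs ++ [r]))) :
    IsGorensteinInjective (R ⧸ Ideal.ofList xs)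
      (M ⧸ (Ideal.ofList xs • (⊤ : Submodule R M))) := by
  obtain ⟨π, D⟩ := cous_of R M _ hM.2.2
  have hz := main_zero M hM xs hxM hxR hmax D
  obtain ⟨e⟩ := D.quot_equiv (D.stage xs hxM) hz
  haveI : IsScalarTower R (R ⧸ Ideal.ofList xs) (M ⧸ (Ideal.ofList xs • (⊤ : Submodule R M))) :=
    .of_algebraMap_smul fun r x => by
      obtain ⟨a, rfl⟩ := Submodule.Quotient.mk_surjective _ x
      rfl
  exact (RelGI.of_regular (hM.2.2.2.2.2 xs.length) xs hxR).to_gi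
    (M ⧸ (Ideal.ofList xs • (⊤ : Submodule R M))) e

end GG
open GG in
/-- For a maximal simultaneously `M`- and `R`-regular sequence `x`, the quotient `M/xM`
is a Gorenstein injective `R/xR`-module. -/
theorem stmt5 (R : Type u) [CommRing R] [IsNoetherianRing R] (hR : HasDualizingComplex R)
    (M : ModuleCat.{u} R) (hM : IsGGorenstein R M) (xs : List R)
    (hxM : RingTheory.Sequence.IsRegular M xs)
    (hxR : RingTheory.Sequence.IsRegular R xs)
    (hmax : ∀ r : R, ¬ (RingTheory.Sequence.IsRegular M (xs ++ [r]) ∧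
      RingTheory.Sequence.IsRegular R (xs ++ [r]))) :
    IsGorensteinInjective (R ⧸ Ideal.span {r | r ∈ xs})
      (M ⧸ (Ideal.span {r | r ∈ xs} • (⊤ : Submodule R M))) := by
  exact main_gi M hM xs hxM.1 hxR.1 hmax
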